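/- Fix a sign σ ∈ {1, −1}. Let u : ℝ → 𝓢(ℝ²; ℂ) be smooth as a map into the Schwartz space and solve i ∂ₜu − Δu + |x|² u + σ u |u|² = 0 pointwise on ℝ × ℝ². Then the Hamiltonian t ↦ ½ ( ‖∇u(t)‖²_{L²} + ‖ |x| u(t) ‖²_{L²} ) + (σ/4) ‖u(t)‖⁴_{L⁴} is constant in t. -/

import Mathlib

open MeasureTheory Complex

noncomputable section

abbrev E2 : Type := EuclideanSpace ℝ (Fin 2)

/-- Partial derivative in the `i`-th coordinate direction. -/
noncomputable def pd (i : Fin 2) (f : E2 → ℂ) : E2 → ℂ :=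
  fun x => fderiv ℝ f x (EuclideanSpace.single i 1)

/-- The Laplacian on `ℝ²`. -/
noncomputable def lap (f : E2 → ℂ) : E2 → ℂ :=
  fun x => ∑ i : Fin 2, pd i (pd i f) x

/-- The harmonic oscillator `A f = -Δ f + |x|² f`. -/
noncomputable def Aop (f : E2 → ℂ) : E2 → ℂ :=
  fun x => -lap f x + (‖x‖ : ℂ)^2 * f x

/-- Time derivative of a time-dependent function. -/
noncomputable def tderiv (F : ℝ → E2 → ℂ) : ℝ → E2 → ℂ :=
  fun t x => deriv (fun s => F s x) t

/-- Squared euclidean norm of the gradient, `|∇f|²(x)`. -/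
noncomputable def gradSq (f : E2 → ℂ) (x : E2) : ℝ := ∑ i : Fin 2, ‖pd i f x‖^2

/-- The `L²` norm. -/
noncomputable def L2norm (f : E2 → ℂ) : ℝ := Real.sqrt (∫ x : E2, ‖f x‖^2)

/-- The `ℋ¹` norm: `(‖∇φ‖² + ‖|x|φ‖²)^(1/2)`. -/
noncomputable def H1norm (f : E2 → ℂ) : ℝ :=
  Real.sqrt ((∫ x : E2, gradSq f x) + ∫ x : E2, ‖x‖^2 * ‖f x‖^2)

/-- A Schwartz-regular solution of the cubic NLS with harmonic potential,
`i ∂ₜ u - Δu + |x|² u + σ u |u|² = 0`. -/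
def IsSolution (σ : ℝ) (u : ℝ → SchwartzMap E2 ℂ) : Prop :=
  ContDiff ℝ (⊤ : ℕ∞) (fun p : ℝ × E2 => u p.1 p.2) ∧
  ∀ (t : ℝ) (x : E2), Complex.I * deriv (fun s => u s x) t - lap (fun y => u t y) x
    + (‖x‖ : ℂ)^2 * u t x + (σ : ℂ) * u t x * (‖u t x‖ : ℂ)^2 = 0

/-- A Schwartz-regular solution of the linear Schrödinger equation with harmonic
potential, `i ∂ₜ w - Δw + |x|² w = 0`. -/
def IsLinSolution (w : ℝ → SchwartzMap E2 ℂ) : Prop :=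
  ContDiff ℝ (⊤ : ℕ∞) (fun p : ℝ × E2 => w p.1 p.2) ∧
  ∀ (t : ℝ) (x : E2), Complex.I * deriv (fun s => w s x) t - lap (fun y => w t y) x
    + (‖x‖ : ℂ)^2 * w t x = 0

/-- Partial derivative for real-valued functions. -/
noncomputable def pdR (i : Fin 2) (f : E2 → ℝ) : E2 → ℝ :=
  fun x => fderiv ℝ f x (EuclideanSpace.single i 1)

/-- The Laplacian for real-valued functions. -/
noncomputable def lapR (f : E2 → ℝ) : E2 → ℝ :=
  fun x => ∑ i : Fin 2, pdR i (pdR i f) x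

section Conservation

/-! ### The algebra of smooth functions on space-time -/

/-- Smooth real functions on `ℝ × ℝ²`. -/
def smoothAlg : Subalgebra ℝ (ℝ × E2 → ℝ) where
  carrier := {F | ContDiff ℝ (⊤ : ℕ∞) F}
  mul_mem' {F G} hf hg := show ContDiff ℝ (⊤ : ℕ∞) (F * G) from ContDiff.mul hf hg
  add_mem' {F G} hf hg := show ContDiff ℝ (⊤ : ℕ∞) (F + G) from ContDiff.add hf hg
  algebraMap_mem' c := show ContDiff ℝ (⊤ : ℕ∞) (fun _ => c) from contDiff_const

abbrev Sm : Type := smoothAlg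

namespace Sm

lemma contDiff (F : Sm) : ContDiff ℝ (⊤ : ℕ∞) F.1 := F.2

lemma continuous (F : Sm) : Continuous F.1 := F.contDiff.continuous

lemma differentiable (F : Sm) : Differentiable ℝ F.1 :=
  F.contDiff.differentiable (by simp)

/-- The directional derivative as a derivation. -/
def D (e : ℝ × E2) : Derivation ℝ Sm Sm :=
  Derivation.mk'
    { toFun := fun F => ⟨fun p => fderiv ℝ F.1 p e,
        (F.contDiff.fderiv_right (m := (⊤ : ℕ∞)) (by simp)).clm_apply contDiff_const⟩
      map_add' := fun F G => by
        ext p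
        simp [fderiv_add (F.differentiable p) (G.differentiable p)]
      map_smul' := fun c F => by
        ext p
        simp [fderiv_const_smul (F.differentiable p)] }
    (fun F G => by
      ext p
      simp [fderiv_mul (F.differentiable p) (G.differentiable p)])

lemma D_apply (e : ℝ × E2) (F : Sm) (p : ℝ × E2) : (D e F).1 p = fderiv ℝ F.1 p e := rfl

lemma D_comm (e e' : ℝ × E2) (F : Sm) : D e (D e' F) = D e' (D e F) := by
  ext p
  have hd : DifferentiableAt ℝ (fderiv ℝ F.1) p :=
    ((F.contDiff.fderiv_right (m := (⊤ : ℕ∞)) (by simp)).differentiable (by simp)) p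
  have h := (F.contDiff.contDiffAt (x := p)).isSymmSndFDerivAt
    (by simpa using (WithTop.coe_le_coe.2 (le_top : (2 : ℕ∞) ≤ ⊤) :
      (2 : WithTop ℕ∞) ≤ ((⊤ : ℕ∞) : WithTop ℕ∞)))
  have key : ∀ v w : ℝ × E2, (D v (D w F)).1 p = fderiv ℝ (fderiv ℝ F.1) p v w := by
    intro v w
    rw [D_apply]
    have : (D w F).1 = fun q => fderiv ℝ F.1 q w := rfl
    rw [this, fderiv_clm_apply hd (differentiableAt_const w)]
    simp
  rw [key, key]
  exact h e e'

/-- Time derivative. -/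
def Dt : Derivation ℝ Sm Sm := D (1, 0)

/-- Space derivative. -/
def Dx (i : Fin 2) : Derivation ℝ Sm Sm := D (0, EuclideanSpace.single i 1)

lemma Dt_Dx (i : Fin 2) (F : Sm) : Dt (Dx i F) = Dx i (Dt F) := D_comm _ _ _

lemma Dx_comm (F : Sm) : Dx 1 (Dx 0 F) = Dx 0 (Dx 1 F) := D_comm _ _ _

lemma hasDerivAt_time (F : Sm) (t : ℝ) (x : E2) :
    HasDerivAt (fun s => F.1 (s, x)) ((Dt F).1 (t, x)) t := by
  have h := (F.differentiable (t, x)).hasFDerivAt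
  have h2 : HasDerivAt (fun s : ℝ => (s, x)) ((1 : ℝ), (0 : E2)) t :=
    (hasDerivAt_id t).prodMk (hasDerivAt_const t x)
  exact h.comp_hasDerivAt t h2

lemma hasFDerivAt_space (F : Sm) (t : ℝ) (x : E2) :
    HasFDerivAt (fun y => F.1 (t, y))
      ((fderiv ℝ F.1 (t, x)).comp (ContinuousLinearMap.inr ℝ ℝ E2)) x := by
  have h := (F.differentiable (t, x)).hasFDerivAt
  exact h.comp x (hasFDerivAt_prodMk_right t x)

lemma contDiff_space (F : Sm) (t : ℝ) : ContDiff ℝ (⊤ : ℕ∞) (fun y => F.1 (t, y)) :=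
  F.contDiff.comp (contDiff_const.prodMk contDiff_id)

lemma continuous_space (F : Sm) (t : ℝ) : Continuous (fun y => F.1 (t, y)) :=
  (F.contDiff_space t).continuous

lemma continuous_time (F : Sm) (x : E2) : Continuous (fun t => F.1 (t, x)) :=
  F.continuous.comp (by fun_prop)

lemma fderiv_space (F : Sm) (t : ℝ) (x : E2) (i : Fin 2) :
    fderiv ℝ (fun y => F.1 (t, y)) x (EuclideanSpace.single i 1) = (Dx i F).1 (t, x) := by
  rw [(F.hasFDerivAt_space t x).fderiv]
  rfl

/-- The coordinate functions. -/
def X (i : Fin 2) : Sm := ⟨fun p => p.2 i, by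
  have : ContDiff ℝ (⊤ : ℕ∞) (fun p : ℝ × E2 => (EuclideanSpace.proj i : E2 →L[ℝ] ℝ) p.2) :=
    (ContinuousLinearMap.contDiff _).comp contDiff_snd
  exact this⟩

lemma D_X (e : ℝ × E2) (i : Fin 2) : D e (X i) = algebraMap ℝ Sm (e.2 i) := by
  ext p
  rw [D_apply]
  have h : HasFDerivAt (X i).1 ((EuclideanSpace.proj i : E2 →L[ℝ] ℝ).comp
      (ContinuousLinearMap.snd ℝ ℝ E2)) p :=
    ((EuclideanSpace.proj i : E2 →L[ℝ] ℝ).comp (ContinuousLinearMap.snd ℝ ℝ E2)).hasFDerivAt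
  rw [h.fderiv]
  rfl

@[simp] lemma Dt_X (i : Fin 2) : Dt (X i) = 0 := by
  rw [Dt, D_X]; simp

@[simp] lemma Dx_X_same (i : Fin 2) : Dx i (X i) = 1 := by
  rw [Dx, D_X]; simp

@[simp] lemma Dx_zero_X_one : Dx 0 (X 1) = 0 := by
  rw [Dx, D_X]; simp

@[simp] lemma Dx_one_X_zero : Dx 1 (X 0) = 0 := by
  rw [Dx, D_X]; simp

/-- `|x|²` as a smooth function. -/
def X2 : Sm := X 0 * X 0 + X 1 * X 1

lemma X2_apply (t : ℝ) (x : E2) : X2.1 (t, x) = ‖x‖ ^ 2 := by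
  have : X2.1 (t, x) = x 0 * x 0 + x 1 * x 1 := rfl
  rw [this, EuclideanSpace.norm_sq_eq, Fin.sum_univ_two]
  simp [sq]

/-- The spatial Laplacian. -/
def Lap (F : Sm) : Sm := Dx 0 (Dx 0 F) + Dx 1 (Dx 1 F)

end Sm

namespace Sm

/-! ### Pointwise conservation laws -/

/-- Schwartz on each time slice. -/
def IsS (F : Sm) : Prop := ∀ t, ∃ f : SchwartzMap E2 ℝ, ∀ x, F.1 (t, x) = f x

/-- The pair `(a, b)` of real and imaginary parts of a Schwartz-regular solution. -/
structure RSol (σ : ℝ) (a b : Sm) : Prop where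
  dt_re : Dt a = Lap b - (X2 + algebraMap ℝ Sm σ * (a * a + b * b)) * b
  dt_im : Dt b = -(Lap a - (X2 + algebraMap ℝ Sm σ * (a * a + b * b)) * a)
  re : IsS a
  im : IsS b

/-- Mass density. -/
def mass (a b : Sm) : Sm := a * a + b * b

/-- `|∇u|²`. -/
def grad (a b : Sm) : Sm :=
  Dx 0 a * Dx 0 a + Dx 1 a * Dx 1 a + (Dx 0 b * Dx 0 b + Dx 1 b * Dx 1 b)

/-- Four times the energy density. -/
def energy (σ : ℝ) (a b : Sm) : Sm :=
  2 * grad a b + 2 * (X2 * mass a b) + algebraMap ℝ Sm σ * (mass a b * mass a b)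

/-- The mass flux `2 Im(ū ∂ᵢu)`. -/
def current (i : Fin 2) (a b : Sm) : Sm := 2 * (a * Dx i b - b * Dx i a)

/-- The virial density `Im(ū x·∇u)`. -/
def virial (a b : Sm) : Sm :=
  X 0 * (a * Dx 0 b - b * Dx 0 a) + X 1 * (a * Dx 1 b - b * Dx 1 a)

/-- The Euler field `x·∇`. -/
def Eul (a : Sm) : Sm := X 0 * Dx 0 a + X 1 * Dx 1 a

/-- The flux of the virial density. -/
def virialFlux (σ : ℝ) (i : Fin 2) (a b : Sm) : Sm :=
  X i * (a * Dt b - b * Dt a) + 2 * (a * Dx i a + b * Dx i b)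
    + 2 * (Dx i a * Eul a + Dx i b * Eul b) - X i * grad a b
    - X i * (X2 * mass a b)
    - algebraMap ℝ Sm (σ / 2) * (X i * (mass a b * mass a b))

variable {σ : ℝ} {a b : Sm}

lemma Dx_two (i : Fin 2) : Dx i (2 : Sm) = 0 := by
  have : (2 : Sm) = algebraMap ℝ Sm 2 := (map_ofNat _ 2).symm
  rw [this, Derivation.map_algebraMap]

lemma Dt_two : Dt (2 : Sm) = 0 := by
  have : (2 : Sm) = algebraMap ℝ Sm 2 := (map_ofNat _ 2).symm
  rw [this, Derivation.map_algebraMap]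

set_option linter.unusedSimpArgs false in
lemma mass_law (h : RSol σ a b) :
    Dt (mass a b) = Dx 0 (current 0 a b) + Dx 1 (current 1 a b) + 0 := by
  simp only [mass, current, map_add, map_sub, map_neg, Derivation.leibniz, smul_eq_mul, Dx_two,
    Dt_two, h.dt_re, h.dt_im, Lap]
  ring

set_option linter.unusedSimpArgs false in
lemma energy_law (h : RSol σ a b) :
    Dt (energy σ a b) = Dx 0 (4 * (Dx 0 a * Dt a + Dx 0 b * Dt b))
      + Dx 1 (4 * (Dx 1 a * Dt a + Dx 1 b * Dt b)) + 0 := by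
  have h4 : (4 : Sm) = 2 * 2 := by norm_num
  simp only [energy, grad, mass, X2, h4, map_add, map_sub, map_neg, Derivation.leibniz,
    smul_eq_mul, Dx_two, Dt_two, Dt_Dx, Dt_X, Derivation.map_algebraMap]
  have e1 := h.dt_re
  have e2 := h.dt_im
  simp only [Lap, X2] at e1 e2
  linear_combination (4 * Dt b) * e1 - (4 * Dt a) * e2

set_option linter.unusedSimpArgs false in
lemma variance_law (h : RSol σ a b) :
    Dt (X2 * mass a b) = Dx 0 (X2 * current 0 a b) + Dx 1 (X2 * current 1 a b)
      + -(2 * (2 * virial a b)) := by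
  simp only [virial, X2, mass, current, map_add, map_sub, map_neg, Derivation.leibniz, smul_eq_mul,
    Dx_two, Dt_two, Dt_X, Dx_X_same, Dx_zero_X_one, Dx_one_X_zero, h.dt_re, h.dt_im, Lap]
  ring

set_option linter.unusedSimpArgs false in
lemma virial_law (h : RSol σ a b) :
    Dt (virial a b) = Dx 0 (virialFlux σ 0 a b) + Dx 1 (virialFlux σ 1 a b)
      + (2 * (2 * (X2 * mass a b)) - energy σ a b) := by
  have hs : algebraMap ℝ Sm σ = 2 * algebraMap ℝ Sm (σ / 2) := by
    rw [← map_ofNat (algebraMap ℝ Sm) 2, ← map_mul]; congr 1; ring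
  simp only [virial, virialFlux, Eul, energy, grad, X2, mass, map_add, map_sub, map_neg,
    Derivation.leibniz, smul_eq_mul, Dx_two, Dt_two, Dt_X, Dx_X_same, Dx_zero_X_one,
    Dx_one_X_zero, Dt_Dx, Derivation.map_algebraMap, Dx_comm, hs]
  have e1 := h.dt_re
  have e2 := h.dt_im
  simp only [Lap, X2, hs] at e1 e2
  linear_combination (2 * (X 0 * Dx 0 b + X 1 * Dx 1 b) + 2 * b) * e1
    - (2 * (X 0 * Dx 0 a + X 1 * Dx 1 a) + 2 * a) * e2

end Sm

namespace Sm

/-! ### Schwartz time slices -/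

namespace IsS

lemma add {F G : Sm} (hF : IsS F) (hG : IsS G) : IsS (F + G) := fun t => by
  obtain ⟨f, hf⟩ := hF t
  obtain ⟨g, hg⟩ := hG t
  exact ⟨f + g, fun x => by simp [hf, hg]⟩

lemma neg {F : Sm} (hF : IsS F) : IsS (-F) := fun t => by
  obtain ⟨f, hf⟩ := hF t
  exact ⟨-f, fun x => by simp [hf]⟩

lemma sub {F G : Sm} (hF : IsS F) (hG : IsS G) : IsS (F - G) := by
  rw [sub_eq_add_neg]; exact hF.add hG.neg

lemma mul_left {F G : Sm} (hG : ∀ t, Function.HasTemperateGrowth (fun x => G.1 (t, x)))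
    (hF : IsS F) : IsS (G * F) := fun t => by
  obtain ⟨f, hf⟩ := hF t
  exact ⟨SchwartzMap.smulLeftCLM ℝ (fun x => G.1 (t, x)) f, fun x => by
    rw [SchwartzMap.smulLeftCLM_apply_apply (hG t)]; simp [hf]⟩

lemma mul {F G : Sm} (hF : IsS F) (hG : IsS G) : IsS (F * G) := by
  refine mul_left (fun t => ?_) hG
  obtain ⟨f, hf⟩ := hF t
  simp_rw [hf]
  exact f.hasTemperateGrowth

lemma temperate_X (i : Fin 2) (t : ℝ) : Function.HasTemperateGrowth (fun x => (X i).1 (t, x)) :=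
  (EuclideanSpace.proj i : E2 →L[ℝ] ℝ).hasTemperateGrowth

lemma X_mul {F : Sm} (i : Fin 2) (hF : IsS F) : IsS (X i * F) := mul_left (temperate_X i) hF

lemma X2_mul {F : Sm} (hF : IsS F) : IsS (X2 * F) := by
  rw [X2, add_mul, mul_assoc, mul_assoc]
  exact (X_mul 0 (X_mul 0 hF)).add (X_mul 1 (X_mul 1 hF))

lemma const_mul {F : Sm} (c : ℝ) (hF : IsS F) : IsS (algebraMap ℝ Sm c * F) :=
  mul_left (fun _ => Function.HasTemperateGrowth.const c) hF

lemma ofNat_mul {F : Sm} (n : ℕ) [n.AtLeastTwo] (hF : IsS F) :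
    IsS ((OfNat.ofNat n : Sm) * F) := by
  have : (OfNat.ofNat n : Sm) = algebraMap ℝ Sm (OfNat.ofNat n) := (map_ofNat _ n).symm
  rw [this]
  exact const_mul _ hF

lemma dx {F : Sm} (i : Fin 2) (hF : IsS F) : IsS (Dx i F) := fun t => by
  obtain ⟨f, hf⟩ := hF t
  refine ⟨LineDeriv.lineDerivOp (EuclideanSpace.single i (1 : ℝ)) f, fun x => ?_⟩
  rw [← fderiv_space, SchwartzMap.lineDerivOp_apply_eq_fderiv]
  simp_rw [hf]

lemma lap {F : Sm} (hF : IsS F) : IsS (Lap F) := ((hF.dx 0).dx 0).add ((hF.dx 1).dx 1)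

lemma integrable {F : Sm} (hF : IsS F) (t : ℝ) : Integrable (fun x => F.1 (t, x)) := by
  obtain ⟨f, hf⟩ := hF t
  simp_rw [hf]
  exact f.integrable

lemma bounded {F : Sm} (hF : IsS F) (t : ℝ) : ∃ C, ∀ x, F.1 (t, x) ≤ C := by
  obtain ⟨f, hf⟩ := hF t
  obtain ⟨C, hC⟩ := f.decay 0 0
  refine ⟨C, fun x => ?_⟩
  have := hC.2 x
  rw [hf]
  simp at this
  exact (le_abs_self _).trans this

end IsS

variable {σ : ℝ} {a b : Sm}

lemma isS_mass (ha : IsS a) (hb : IsS b) : IsS (mass a b) := (ha.mul ha).add (hb.mul hb)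

lemma isS_grad (ha : IsS a) (hb : IsS b) : IsS (grad a b) :=
  (((ha.dx 0).mul (ha.dx 0)).add ((ha.dx 1).mul (ha.dx 1))).add
    (((hb.dx 0).mul (hb.dx 0)).add ((hb.dx 1).mul (hb.dx 1)))

lemma isS_energy (ha : IsS a) (hb : IsS b) : IsS (energy σ a b) :=
  ((IsS.ofNat_mul 2 (isS_grad ha hb)).add (IsS.ofNat_mul 2 (isS_mass ha hb).X2_mul)).add
    (IsS.const_mul σ ((isS_mass ha hb).mul (isS_mass ha hb)))

lemma isS_virial (ha : IsS a) (hb : IsS b) : IsS (virial a b) :=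
  (IsS.X_mul 0 ((ha.mul (hb.dx 0)).sub (hb.mul (ha.dx 0)))).add
    (IsS.X_mul 1 ((ha.mul (hb.dx 1)).sub (hb.mul (ha.dx 1))))

lemma RSol.isS_dt_re (h : RSol σ a b) : IsS (Dt a) := by
  rw [h.dt_re, add_mul, mul_assoc]
  exact h.im.lap.sub (h.im.X2_mul.add (IsS.const_mul σ ((isS_mass h.re h.im).mul h.im)))

lemma RSol.isS_dt_im (h : RSol σ a b) : IsS (Dt b) := by
  rw [h.dt_im, add_mul, mul_assoc]
  exact (h.re.lap.sub (h.re.X2_mul.add (IsS.const_mul σ ((isS_mass h.re h.im).mul h.re)))).neg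

end Sm

open Filter Topology Set

/-! ### Cutoffs and the flux lemma -/

/-- Smooth cutoffs at scale `n + 1`, with derivative decaying like the inverse scale. -/
lemma exists_cutoff : ∃ (χ : ℕ → E2 → ℝ) (K : ℝ), 0 ≤ K ∧
    (∀ n, ContDiff ℝ 1 (χ n)) ∧ (∀ n, HasCompactSupport (χ n)) ∧
    (∀ n x, |χ n x| ≤ 1) ∧ (∀ x, Tendsto (fun n => χ n x) atTop (𝓝 1)) ∧
    (∀ n x, ‖fderiv ℝ (χ n) x‖ * (1 + ‖x‖) ≤ K) ∧
    (∀ n x, ‖fderiv ℝ (χ n) x‖ ≤ K / (n + 1)) := by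
  let f : ContDiffBump (0 : E2) := ⟨1, 2, one_pos, one_lt_two⟩
  have hf1 : ContDiff ℝ 1 f := f.contDiff
  have hcont : Continuous (fun y : E2 => ‖fderiv ℝ f y‖ * (1 + ‖y‖)) :=
    ((hf1.continuous_fderiv one_ne_zero).norm).mul (by fun_prop)
  have hcs : HasCompactSupport (fun y : E2 => ‖fderiv ℝ f y‖ * (1 + ‖y‖)) :=
    (f.hasCompactSupport.fderiv (𝕜 := ℝ)).norm.mul_right
  obtain ⟨K, hK⟩ := hcs.exists_bound_of_continuous hcont
  have hK' : ∀ y, ‖fderiv ℝ f y‖ * (1 + ‖y‖) ≤ K := fun y => (le_abs_self _).trans (hK y)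
  have hK0 : 0 ≤ K := (norm_nonneg _).trans (hK 0)
  have hder : ∀ (n : ℕ) (x : E2), fderiv ℝ (fun x : E2 => f (((n : ℝ) + 1)⁻¹ • x)) x
      = ((n : ℝ) + 1)⁻¹ • fderiv ℝ f (((n : ℝ) + 1)⁻¹ • x) := by
    intro n x
    exact fderiv_comp_smul _
  have hn : ∀ n : ℕ, (0 : ℝ) < (n : ℝ) + 1 := fun n => by positivity
  refine ⟨fun n x => f (((n : ℝ) + 1)⁻¹ • x), K, hK0, fun n => hf1.comp (by fun_prop), fun n => ?_,
    fun n x => ?_, fun x => ?_, fun n x => ?_, fun n x => ?_⟩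
  · exact f.hasCompactSupport.comp_smul (inv_ne_zero (hn n).ne')
  · rw [abs_of_nonneg f.nonneg]; exact f.le_one
  · have h1 : Tendsto (fun n : ℕ => ((n : ℝ) + 1)⁻¹ • x) atTop (𝓝 ((0 : ℝ) • x)) := by
      refine Tendsto.smul_const ?_ x
      simpa using tendsto_one_div_add_atTop_nhds_zero_nat (𝕜 := ℝ)
    have h2 := (f.continuous.tendsto ((0 : ℝ) • x)).comp h1
    have h3 : f ((0 : ℝ) • x) = 1 := f.one_of_mem_closedBall (by simp [f])
    rw [h3] at h2
    exact h2
  · rw [hder, norm_smul, norm_inv, Real.norm_of_nonneg (hn n).le]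
    refine le_trans ?_ (hK' (((n : ℝ) + 1)⁻¹ • x))
    rw [norm_smul, norm_inv, Real.norm_of_nonneg (hn n).le, mul_assoc, mul_left_comm]
    gcongr
    rw [mul_add, mul_one]
    gcongr
    exact inv_le_one_of_one_le₀ (by linarith [Nat.cast_nonneg (α := ℝ) n])
  · rw [hder, norm_smul, norm_inv, Real.norm_of_nonneg (hn n).le, div_eq_inv_mul]
    gcongr
    refine le_trans ?_ (hK' (((n : ℝ) + 1)⁻¹ • x))
    exact le_mul_of_one_le_right (norm_nonneg _) (by linarith [norm_nonneg (((n : ℝ) + 1)⁻¹ • x)])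

lemma norm_clm_single_le (L : E2 →L[ℝ] ℝ) (i : Fin 2) : |L (EuclideanSpace.single i 1)| ≤ ‖L‖ := by
  simpa using L.le_opNorm (EuclideanSpace.single i (1 : ℝ))

namespace Sm

lemma integral_cutoff_mul_dx {χ : E2 → ℝ} (hχ : ContDiff ℝ 1 χ) (hc : HasCompactSupport χ)
    (J : Sm) (i : Fin 2) (τ : ℝ) :
    ∫ x, χ x * (Dx i J).1 (τ, x)
      = - ∫ x, fderiv ℝ χ x (EuclideanSpace.single i 1) * J.1 (τ, x) := by
  have hJ := J.contDiff_space τ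
  have h := integral_mul_fderiv_eq_neg_fderiv_mul_of_integrable (μ := (volume : Measure E2))
    (f := χ) (g := fun x => J.1 (τ, x)) (v := EuclideanSpace.single i 1) ?_ ?_ ?_
    (fun x _ => (hχ.differentiable one_ne_zero) x) (fun x _ => (hJ.differentiable (by simp)) x)
  · simpa only [fderiv_space] using h
  · refine Continuous.integrable_of_hasCompactSupport
      (((hχ.continuous_fderiv one_ne_zero).clm_apply continuous_const).mul hJ.continuous) ?_
    exact (hc.fderiv_apply (𝕜 := ℝ) _).mul_right
  · simp only [fderiv_space]
    exact (hχ.continuous.mul (continuous_space _ _)).integrable_of_hasCompactSupport hc.mul_right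
  · exact (hχ.continuous.mul hJ.continuous).integrable_of_hasCompactSupport hc.mul_right

lemma integral_cutoff_mul_dt {χ : E2 → ℝ} (hχ : Continuous χ) (hc : HasCompactSupport χ)
    (q : Sm) {s t : ℝ} (hst : s ≤ t) :
    ∫ τ in s..t, ∫ x, χ x * (Dt q).1 (τ, x) = ∫ x, χ x * (q.1 (t, x) - q.1 (s, x)) := by
  have hcont : Continuous (fun p : ℝ × E2 => χ p.2 * (Dt q).1 p) :=
    (hχ.comp continuous_snd).mul (Dt q).continuous
  rw [intervalIntegral_integral_swap]
  · refine integral_congr_ae (Eventually.of_forall fun x => ?_)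
    simp only
    rw [intervalIntegral.integral_const_mul]
    congr 1
    exact intervalIntegral.integral_eq_sub_of_hasDerivAt (fun τ _ => q.hasDerivAt_time τ x)
      ((continuous_time _ _).intervalIntegrable _ _)
  · have hK : IsCompact (Icc s t ×ˢ tsupport χ) := isCompact_Icc.prod hc
    have h1 : IntegrableOn (fun p : ℝ × E2 => χ p.2 * (Dt q).1 p) (Icc s t ×ˢ tsupport χ)
        (volume.prod volume) := hcont.continuousOn.integrableOn_compact hK
    have h2 : IntegrableOn (fun p : ℝ × E2 => χ p.2 * (Dt q).1 p) (Icc s t ×ˢ univ)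
        (volume.prod volume) := by
      refine h1.of_forall_sdiff_eq_zero (measurableSet_Icc.prod MeasurableSet.univ) ?_
      rintro ⟨τ, x⟩ hp
      have : x ∉ tsupport χ := fun hx => hp.2 ⟨hp.1.1, hx⟩
      simp [image_eq_zero_of_notMem_tsupport this]
    rw [uIoc_of_le hst]
    have h3 := h2.mono_set (prod_mono_left (t := (univ : Set E2))
      (Ioc_subset_Icc_self (a := s) (b := t)))
    rw [IntegrableOn, ← Measure.prod_restrict, Measure.restrict_univ] at h3
    exact h3

/-- Integrated conservation law for a density whose flux grows at most linearly compared to a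
uniformly integrable dominating function. -/
lemma flux {q J₀ J₁ r : Sm} (h : Dt q = Dx 0 J₀ + Dx 1 J₁ + r) {s t : ℝ} (hst : s ≤ t)
    (hq : ∀ τ, Integrable (fun x => q.1 (τ, x))) {dom : ℝ → E2 → ℝ} {C : ℝ}
    (hdi : ∀ τ ∈ Icc s t, Integrable (dom τ)) (hdC : ∀ τ ∈ Icc s t, ∫ x, dom τ x ≤ C)
    (h₀ : ∀ τ ∈ Icc s t, ∀ x, |J₀.1 (τ, x)| ≤ (1 + ‖x‖) * dom τ x)
    (h₁ : ∀ τ ∈ Icc s t, ∀ x, |J₁.1 (τ, x)| ≤ (1 + ‖x‖) * dom τ x)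
    (hr : ∀ τ ∈ Icc s t, ∀ x, |r.1 (τ, x)| ≤ dom τ x) :
    IntervalIntegrable (fun τ => ∫ x, r.1 (τ, x)) volume s t ∧
    (∫ x, q.1 (t, x)) - (∫ x, q.1 (s, x)) = ∫ τ in s..t, ∫ x, r.1 (τ, x) := by
  obtain ⟨χ, K, hK0, hsm, hcs, hle, hlim, hder, hder'⟩ := exists_cutoff
  have hχc : ∀ n, Continuous (χ n) := fun n => (hsm n).continuous
  have hdc : ∀ n (i : Fin 2), Continuous fun x => fderiv ℝ (χ n) x (EuclideanSpace.single i 1) :=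
    fun n i => ((hsm n).continuous_fderiv one_ne_zero).clm_apply continuous_const
  have hd0 : ∀ τ ∈ Icc s t, ∀ x, 0 ≤ dom τ x := fun τ hτ x => (abs_nonneg _).trans (hr τ hτ x)
  -- localized identity in space
  have hloc : ∀ n, ∀ τ, ∫ x, χ n x * (Dt q).1 (τ, x) = ∫ x, (χ n x * r.1 (τ, x)
      - fderiv ℝ (χ n) x (EuclideanSpace.single 0 1) * J₀.1 (τ, x)
      - fderiv ℝ (χ n) x (EuclideanSpace.single 1 1) * J₁.1 (τ, x)) := by
    intro n τ
    have i1 : ∀ F : Sm, Integrable (fun x => χ n x * F.1 (τ, x)) := fun F =>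
      ((hχc n).mul (continuous_space _ _)).integrable_of_hasCompactSupport (hcs n).mul_right
    have i2 : ∀ (F : Sm) (i : Fin 2),
        Integrable (fun x => fderiv ℝ (χ n) x (EuclideanSpace.single i 1) * F.1 (τ, x)) :=
      fun F i => ((hdc n i).mul (continuous_space _ _)).integrable_of_hasCompactSupport
        ((hcs n).fderiv_apply (𝕜 := ℝ) _).mul_right
    have i3 : Integrable (fun x => χ n x * r.1 (τ, x)
        - fderiv ℝ (χ n) x (EuclideanSpace.single 0 1) * J₀.1 (τ, x)) := (i1 r).sub (i2 J₀ 0)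
    have i4 : Integrable (fun x => χ n x * r.1 (τ, x) + χ n x * (Dx 0 J₀).1 (τ, x)) :=
      (i1 r).add (i1 _)
    rw [integral_sub i3 (i2 J₁ 1), integral_sub (i1 r) (i2 J₀ 0),
      sub_eq_add_neg, sub_eq_add_neg, ← integral_cutoff_mul_dx (hsm n) (hcs n),
      ← integral_cutoff_mul_dx (hsm n) (hcs n), ← integral_add (i1 r) (i1 _),
      ← integral_add i4 (i1 _), h]
    refine integral_congr_ae (Eventually.of_forall fun x => ?_)
    simp only [Subalgebra.coe_add, Pi.add_apply]
    ring
  have hbd : ∀ n, ∀ τ ∈ Icc s t, ∀ x, ‖χ n x * r.1 (τ, x)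
      - fderiv ℝ (χ n) x (EuclideanSpace.single 0 1) * J₀.1 (τ, x)
      - fderiv ℝ (χ n) x (EuclideanSpace.single 1 1) * J₁.1 (τ, x)‖ ≤ (1 + 2 * K) * dom τ x := by
    intro n τ hτ x
    have hJ : ∀ (J : Sm) (i : Fin 2), |J.1 (τ, x)| ≤ (1 + ‖x‖) * dom τ x →
        |fderiv ℝ (χ n) x (EuclideanSpace.single i 1) * J.1 (τ, x)| ≤ K * dom τ x := by
      intro J i hJ
      rw [abs_mul]
      calc _ ≤ ‖fderiv ℝ (χ n) x‖ * ((1 + ‖x‖) * dom τ x) := by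
            gcongr
            exact norm_clm_single_le _ _
        _ = (‖fderiv ℝ (χ n) x‖ * (1 + ‖x‖)) * dom τ x := by ring
        _ ≤ _ := by
            gcongr
            · exact hd0 τ hτ x
            · exact hder n x
    have e1 := hJ J₀ 0 (h₀ τ hτ x)
    have e2 := hJ J₁ 1 (h₁ τ hτ x)
    have e3 : |χ n x * r.1 (τ, x)| ≤ dom τ x := by
      rw [abs_mul]
      calc _ ≤ 1 * dom τ x := by gcongr; exacts [hle n x, hr τ hτ x]
        _ = _ := one_mul _
    rw [Real.norm_eq_abs]
    refine (abs_sub _ _).trans ?_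
    refine (add_le_add (abs_sub _ _) le_rfl).trans ?_
    linarith
  have hder0 : ∀ x (i : Fin 2), Tendsto (fun n => fderiv ℝ (χ n) x (EuclideanSpace.single i 1))
      atTop (𝓝 0) := by
    intro x i
    refine squeeze_zero_norm (fun n => (norm_clm_single_le _ i).trans (hder' n x)) ?_
    exact tendsto_const_div_atTop_nhds_zero_nat K |>.comp (tendsto_add_atTop_nat 1) |>.congr
      (fun n => by simp)
  have hpt : ∀ τ ∈ Icc s t, Tendsto (fun n => ∫ x, χ n x * (Dt q).1 (τ, x)) atTop
      (𝓝 (∫ x, r.1 (τ, x))) := by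
    intro τ hτ
    simp_rw [hloc]
    refine tendsto_integral_of_dominated_convergence (fun x => (1 + 2 * K) * dom τ x) (fun n => ?_)
      ((hdi τ hτ).const_mul _) (fun n => Eventually.of_forall (hbd n τ hτ))
      (Eventually.of_forall fun x => ?_)
    · exact ((((hχc n).mul (continuous_space _ _)).sub ((hdc n 0).mul (continuous_space _ _))).sub
        ((hdc n 1).mul (continuous_space _ _))).aestronglyMeasurable
    · have := (((hlim x).mul_const (r.1 (τ, x))).sub ((hder0 x 0).mul_const (J₀.1 (τ, x)))).sub
        ((hder0 x 1).mul_const (J₁.1 (τ, x)))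
      simpa using this
  have hmeas : ∀ F : ℝ × E2 → ℝ, Continuous F → StronglyMeasurable fun τ => ∫ x, F (τ, x) :=
    fun F hF => hF.stronglyMeasurable.integral_prod_right'
  constructor
  · rw [intervalIntegrable_iff_integrableOn_Ioc_of_le hst]
    refine Measure.integrableOn_of_bounded (M := C) (by simp)
      (hmeas _ r.continuous).aestronglyMeasurable ?_
    refine (ae_restrict_mem measurableSet_Ioc).mono fun τ hτ => ?_
    have hτ' := Ioc_subset_Icc_self hτ
    exact (norm_integral_le_of_norm_le (hdi τ hτ') (Eventually.of_forall (hr τ hτ'))).trans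
      (hdC τ hτ')
  · have hL : Tendsto (fun n => ∫ x, χ n x * (q.1 (t, x) - q.1 (s, x))) atTop
        (𝓝 (∫ x, (q.1 (t, x) - q.1 (s, x)))) := by
      have hi := (hq t).sub (hq s)
      refine tendsto_integral_of_dominated_convergence _ (fun n => ?_) hi.norm
        (fun n => Eventually.of_forall fun x => ?_) (Eventually.of_forall fun x => ?_)
      · exact ((hχc n).mul ((continuous_space _ _).sub (continuous_space _ _))).aestronglyMeasurable
      · rw [norm_mul]
        exact mul_le_of_le_one_left (norm_nonneg _) (hle n x)
      · simpa using (hlim x).mul_const (q.1 (t, x) - q.1 (s, x))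
    have hR : Tendsto (fun n => ∫ τ in s..t, ∫ x, χ n x * (Dt q).1 (τ, x)) atTop
        (𝓝 (∫ τ in s..t, ∫ x, r.1 (τ, x))) := by
      refine intervalIntegral.tendsto_integral_filter_of_dominated_convergence
        (fun _ => (1 + 2 * K) * C) (Eventually.of_forall fun n => ?_)
        (Eventually.of_forall fun n => Eventually.of_forall fun τ hτ => ?_)
        intervalIntegrable_const (Eventually.of_forall fun τ hτ => ?_)
      · exact (hmeas (fun p => χ n p.2 * (Dt q).1 p)
          (((hχc n).comp continuous_snd).mul (Dt q).continuous)).aestronglyMeasurable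
      · rw [uIoc_of_le hst] at hτ
        have hτ' := Ioc_subset_Icc_self hτ
        rw [hloc]
        refine (norm_integral_le_of_norm_le ((hdi τ hτ').const_mul _)
          (Eventually.of_forall (hbd n τ hτ'))).trans ?_
        rw [integral_const_mul]
        gcongr
        exact hdC τ hτ'
      · rw [uIoc_of_le hst] at hτ
        exact hpt τ (Ioc_subset_Icc_self hτ)
    rw [← integral_sub (hq t) (hq s)]
    refine tendsto_nhds_unique hL (hR.congr fun n => ?_)
    exact integral_cutoff_mul_dt (hχc n) (hcs n) q hst

end Sm

namespace Sm

/-! ### Evaluation and integration over time slices -/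

section apply

variable (F G a b : Sm) (p : ℝ × E2)

lemma add_apply : (F + G).1 p = F.1 p + G.1 p := rfl
lemma sub_apply : (F - G).1 p = F.1 p - G.1 p := rfl
lemma mul_apply : (F * G).1 p = F.1 p * G.1 p := rfl
lemma neg_apply : (-F).1 p = -F.1 p := rfl
lemma zero_apply : (0 : Sm).1 p = 0 := rfl
lemma const_apply (c : ℝ) : (algebraMap ℝ Sm c).1 p = c := rfl
lemma ofNat_apply (n : ℕ) [n.AtLeastTwo] : (OfNat.ofNat n : Sm).1 p = OfNat.ofNat n := by
  rw [(map_ofNat (algebraMap ℝ Sm) n).symm, const_apply]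
lemma two_apply : (2 : Sm).1 p = 2 := ofNat_apply p 2
lemma four_apply : (4 : Sm).1 p = 4 := ofNat_apply p 4
lemma X2_eq : X2.1 p = ‖p.2‖ ^ 2 := X2_apply p.1 p.2
lemma X_apply (i : Fin 2) : (X i).1 p = p.2 i := rfl

lemma mass_apply : (mass a b).1 p = a.1 p ^ 2 + b.1 p ^ 2 := by
  simp only [mass, add_apply, mul_apply]; ring

lemma grad_apply : (grad a b).1 p = (Dx 0 a).1 p ^ 2 + (Dx 1 a).1 p ^ 2
    + ((Dx 0 b).1 p ^ 2 + (Dx 1 b).1 p ^ 2) := by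
  simp only [grad, add_apply, mul_apply]; ring

lemma mass_nonneg : 0 ≤ (mass a b).1 p := by rw [mass_apply]; positivity
lemma grad_nonneg : 0 ≤ (grad a b).1 p := by rw [grad_apply]; positivity

/-- The `ℋ¹` density `|u|² + |∇u|² + |x|²|u|²`. -/
def rho (a b : Sm) : Sm := mass a b + grad a b + X2 * mass a b

lemma rho_apply : (rho a b).1 p = (mass a b).1 p + (grad a b).1 p + ‖p.2‖ ^ 2 * (mass a b).1 p := by
  simp only [rho, add_apply, mul_apply, X2_eq]

lemma rho_nonneg : 0 ≤ (rho a b).1 p := by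
  rw [rho_apply]
  have := mass_nonneg a b p
  have := grad_nonneg a b p
  positivity

lemma mass_le_rho : (mass a b).1 p ≤ (rho a b).1 p := by
  rw [rho_apply]
  have := mul_nonneg (sq_nonneg ‖p.2‖) (mass_nonneg a b p)
  have := grad_nonneg a b p
  linarith

end apply

lemma isS_rho {a b : Sm} (ha : IsS a) (hb : IsS b) : IsS (rho a b) :=
  ((isS_mass ha hb).add (isS_grad ha hb)).add (isS_mass ha hb).X2_mul

lemma abs_coord_le (x : E2) (i : Fin 2) : |x i| ≤ ‖x‖ := by
  simpa using PiLp.norm_apply_le x i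

/-- The space integral at a given time. -/
def I (F : Sm) (t : ℝ) : ℝ := ∫ x, F.1 (t, x)

section I

variable {F G : Sm}

lemma I_nonneg {t : ℝ} (h : ∀ x, 0 ≤ F.1 (t, x)) : 0 ≤ I F t := integral_nonneg h

lemma I_add (hF : IsS F) (hG : IsS G) (t : ℝ) : I (F + G) t = I F t + I G t :=
  integral_add (hF.integrable t) (hG.integrable t)

lemma I_sub (hF : IsS F) (hG : IsS G) (t : ℝ) : I (F - G) t = I F t - I G t :=
  integral_sub (hF.integrable t) (hG.integrable t)

lemma I_neg (t : ℝ) : I (-F) t = -I F t := integral_neg _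

lemma I_const_mul (c : ℝ) (t : ℝ) : I (algebraMap ℝ Sm c * F) t = c * I F t :=
  integral_const_mul c _

lemma I_ofNat_mul (n : ℕ) [n.AtLeastTwo] (t : ℝ) :
    I ((OfNat.ofNat n : Sm) * F) t = OfNat.ofNat n * I F t := by
  rw [(map_ofNat (algebraMap ℝ Sm) n).symm, I_const_mul]

lemma I_mono (hF : IsS F) (hG : IsS G) {t : ℝ} (h : ∀ x, F.1 (t, x) ≤ G.1 (t, x)) :
    I F t ≤ I G t :=
  integral_mono (hF.integrable t) (hG.integrable t) h

lemma abs_I_le (hG : IsS G) {t : ℝ} (h : ∀ x, |F.1 (t, x)| ≤ G.1 (t, x)) :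
    |I F t| ≤ I G t := by
  refine norm_integral_le_of_norm_le (f := fun x => F.1 (t, x)) (hG.integrable t) ?_
  exact Eventually.of_forall h

lemma I_rho {a b : Sm} (ha : IsS a) (hb : IsS b) (t : ℝ) :
    I (rho a b) t = I (mass a b) t + I (grad a b) t + I (X2 * mass a b) t := by
  rw [rho, I_add ((isS_mass ha hb).add (isS_grad ha hb)) (isS_mass ha hb).X2_mul,
    I_add (isS_mass ha hb) (isS_grad ha hb)]

lemma I_mass_nonneg (a b : Sm) (t : ℝ) : 0 ≤ I (mass a b) t := I_nonneg fun _ => mass_nonneg a b _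
lemma I_grad_nonneg (a b : Sm) (t : ℝ) : 0 ≤ I (grad a b) t := I_nonneg fun _ => grad_nonneg a b _
lemma I_variance_nonneg (a b : Sm) (t : ℝ) : 0 ≤ I (X2 * mass a b) t := I_nonneg fun x => by
  rw [mul_apply, X2_eq]
  exact mul_nonneg (sq_nonneg _) (mass_nonneg a b _)

end I

/-! ### Affine reparametrization of time -/

/-- Composition with `t ↦ c t + h`. -/
def timeAff (c h : ℝ) : Sm →ₐ[ℝ] Sm where
  toFun F := ⟨fun p => F.1 (c * p.1 + h, p.2), F.contDiff.comp (by fun_prop)⟩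
  map_one' := rfl
  map_mul' _ _ := rfl
  map_zero' := rfl
  map_add' _ _ := rfl
  commutes' _ := rfl

lemma timeAff_apply (c h : ℝ) (F : Sm) (t : ℝ) (x : E2) :
    (timeAff c h F).1 (t, x) = F.1 (c * t + h, x) := rfl

lemma Dx_timeAff (c h : ℝ) (i : Fin 2) (F : Sm) :
    Dx i (timeAff c h F) = timeAff c h (Dx i F) := by
  ext ⟨t, x⟩
  rw [timeAff_apply, ← fderiv_space, ← fderiv_space]
  rfl

lemma Dt_timeAff (c h : ℝ) (F : Sm) :
    Dt (timeAff c h F) = algebraMap ℝ Sm c * timeAff c h (Dt F) := by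
  ext ⟨t, x⟩
  rw [mul_apply, const_apply, timeAff_apply]
  have h1 := hasDerivAt_time (timeAff c h F) t x
  have h2 : HasDerivAt (fun s : ℝ => c * s + h) c t := by
    simpa using ((hasDerivAt_id t).const_mul c).add_const h
  have h3 := (hasDerivAt_time F (c * t + h) x).comp t h2
  rw [mul_comm]
  exact h1.unique h3

lemma X2_timeAff (c h : ℝ) : timeAff c h X2 = X2 := rfl

lemma Lap_timeAff (c h : ℝ) (F : Sm) : Lap (timeAff c h F) = timeAff c h (Lap F) := by
  simp only [Lap, Dx_timeAff, map_add]

lemma mass_timeAff (c h : ℝ) (a b : Sm) :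
    mass (timeAff c h a) (timeAff c h b) = timeAff c h (mass a b) := by
  simp only [mass, map_add, map_mul]

lemma grad_timeAff (c h : ℝ) (a b : Sm) :
    grad (timeAff c h a) (timeAff c h b) = timeAff c h (grad a b) := by
  simp only [grad, map_add, map_mul, Dx_timeAff]

lemma rho_timeAff (c h : ℝ) (a b : Sm) :
    rho (timeAff c h a) (timeAff c h b) = timeAff c h (rho a b) := by
  simp only [rho, map_add, map_mul, mass_timeAff, grad_timeAff, X2_timeAff]

lemma I_timeAff (c h : ℝ) (F : Sm) (t : ℝ) : I (timeAff c h F) t = I F (c * t + h) := rfl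

lemma IsS.timeAff {F : Sm} (hF : IsS F) (c h : ℝ) : IsS (timeAff c h F) := fun t => hF (c * t + h)

lemma RSol.shift {σ : ℝ} {a b : Sm} (hs : RSol σ a b) (h : ℝ) :
    RSol σ (timeAff 1 h a) (timeAff 1 h b) where
  dt_re := by
    rw [Dt_timeAff, hs.dt_re, map_one, one_mul]
    simp only [map_sub, map_mul, map_add, X2_timeAff, AlgHom.commutes, Lap_timeAff]
  dt_im := by
    rw [Dt_timeAff, hs.dt_im, map_one, one_mul]
    simp only [map_sub, map_neg, map_mul, map_add, X2_timeAff, AlgHom.commutes, Lap_timeAff]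
  re := hs.re.timeAff _ _
  im := hs.im.timeAff _ _

lemma Lap_neg (F : Sm) : Lap (-F) = -Lap F := by
  simp only [Lap, map_neg]; ring

lemma RSol.reverse {σ : ℝ} {a b : Sm} (hs : RSol σ a b) :
    RSol σ (timeAff (-1) 0 a) (-timeAff (-1) 0 b) where
  dt_re := by
    rw [Dt_timeAff, hs.dt_re, Lap_neg]
    simp only [map_sub, map_neg, map_one, map_mul, map_add, X2_timeAff, AlgHom.commutes,
      Lap_timeAff]
    ring
  dt_im := by
    rw [map_neg, Dt_timeAff, hs.dt_im]
    simp only [map_sub, map_neg, map_one, map_mul, map_add, X2_timeAff, AlgHom.commutes,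
      Lap_timeAff]
    ring
  re := hs.re.timeAff _ _
  im := (hs.im.timeAff _ _).neg

end Sm

namespace Sm

/-! ### Growth of the mass of a difference -/

/-- `e^{-lam t}` as a function on space-time. -/
def decay (lam : ℝ) : Sm := ⟨fun p => Real.exp (-lam * p.1),
  show ContDiff ℝ (⊤ : ℕ∞) (fun p : ℝ × E2 => Real.exp (-lam * p.1)) by fun_prop⟩

lemma decay_apply (lam t : ℝ) (x : E2) : (decay lam).1 (t, x) = Real.exp (-lam * t) := rfl

lemma Dx_decay (lam : ℝ) (i : Fin 2) : Dx i (decay lam) = 0 := by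
  ext ⟨t, x⟩
  rw [← fderiv_space]
  simp [decay_apply, zero_apply]

lemma Dt_decay (lam : ℝ) : Dt (decay lam) = algebraMap ℝ Sm (-lam) * decay lam := by
  ext ⟨t, x⟩
  rw [mul_apply, const_apply, decay_apply]
  have h1 := hasDerivAt_time (decay lam) t x
  have h2 : HasDerivAt (fun s : ℝ => -lam * s) (-lam) t := by
    simpa using (hasDerivAt_id t).const_mul (-lam)
  rw [mul_comm]
  exact h1.unique h2.exp

/-- The source term in the mass balance of an arbitrary pair. -/
def source (a b : Sm) : Sm := 2 * (a * (Dt a - Lap b) + b * (Dt b + Lap a))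

set_option linter.unusedSimpArgs false in
lemma mass_balance (a b : Sm) :
    Dt (mass a b) = Dx 0 (current 0 a b) + Dx 1 (current 1 a b) + source a b := by
  simp only [mass, current, source, map_add, map_sub, map_neg, Derivation.leibniz, smul_eq_mul,
    Dx_two, Dt_two, Lap]
  ring

lemma abs_current_le (i : Fin 2) (a b : Sm) (p : ℝ × E2) :
    |(current i a b).1 p| ≤ (rho a b).1 p := by
  rw [rho_apply]
  have h0 := mul_nonneg (sq_nonneg ‖p.2‖) (mass_nonneg a b p)
  refine le_trans ?_ (le_add_of_nonneg_right h0)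
  rw [mass_apply, grad_apply]
  simp only [current, mul_apply, sub_apply, two_apply]
  rw [abs_le]
  fin_cases i <;> simp only [Fin.zero_eta, Fin.mk_one] <;> constructor <;>
    nlinarith [sq_nonneg (a.1 p + (Dx 0 b).1 p), sq_nonneg (a.1 p - (Dx 0 b).1 p),
      sq_nonneg (b.1 p + (Dx 0 a).1 p), sq_nonneg (b.1 p - (Dx 0 a).1 p),
      sq_nonneg (a.1 p + (Dx 1 b).1 p), sq_nonneg (a.1 p - (Dx 1 b).1 p),
      sq_nonneg (b.1 p + (Dx 1 a).1 p), sq_nonneg (b.1 p - (Dx 1 a).1 p),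
      sq_nonneg ((Dx 0 b).1 p), sq_nonneg ((Dx 1 b).1 p), sq_nonneg ((Dx 0 a).1 p),
      sq_nonneg ((Dx 1 a).1 p)]

lemma mass_growth {a b : Sm} (ha : IsS a) (hb : IsS b) {s t : ℝ} (hst : s ≤ t) {C lam : ℝ}
    (hlam : 0 ≤ lam) (hC : ∀ τ ∈ Icc s t, I (rho a b) τ ≤ C) {T : E2 → ℝ} (hT : Integrable T)
    (hT0 : ∀ x, 0 ≤ T x)
    (hsrc : ∀ τ ∈ Icc s t, ∀ x, |(source a b).1 (τ, x)| ≤ lam * (mass a b).1 (τ, x) + T x) :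
    I (mass a b) t ≤ Real.exp (lam * (t - s)) * (I (mass a b) s + (t - s) * ∫ x, T x) := by
  have hm := isS_mass ha hb
  set e := decay lam with he
  have hlaw : Dt (e * mass a b) = Dx 0 (e * current 0 a b) + Dx 1 (e * current 1 a b)
      + e * (source a b - algebraMap ℝ Sm lam * mass a b) := by
    simp only [Derivation.leibniz, smul_eq_mul, he, Dx_decay, Dt_decay, mass_balance, map_neg]
    ring
  have he1 : ∀ τ ∈ Icc s t, ∀ x, e.1 (τ, x) ≤ Real.exp (-lam * s) := fun τ hτ x => by
    rw [he, decay_apply]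
    exact Real.exp_le_exp.2 (by nlinarith [hτ.1])
  have he0 : ∀ τ x, 0 ≤ e.1 (τ, x) := fun τ x => (Real.exp_pos _).le
  have hI_mul : ∀ τ, I (e * mass a b) τ = Real.exp (-lam * τ) * I (mass a b) τ := fun τ => by
    rw [I, I, ← integral_const_mul]
    rfl
  set Es := Real.exp (-lam * s)
  have hEs : 0 ≤ Es := (Real.exp_pos _).le
  have hρ := isS_rho ha hb
  have hdi : ∀ τ, Integrable fun x => Es * ((1 + 2 * lam) * (rho a b).1 (τ, x) + T x) :=
    fun τ => (((hρ.integrable τ).const_mul _).add hT).const_mul _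
  have hJ : ∀ i, ∀ τ ∈ Icc s t, ∀ x, |(e * current i a b).1 (τ, x)|
      ≤ (1 + ‖x‖) * (Es * ((1 + 2 * lam) * (rho a b).1 (τ, x) + T x)) := by
    intro i τ hτ x
    rw [mul_apply, abs_mul, abs_of_nonneg (he0 τ x)]
    have h1 := abs_current_le i a b (τ, x)
    have h2 := rho_nonneg a b (τ, x)
    have h3 : 0 ≤ Es * ((1 + 2 * lam) * (rho a b).1 (τ, x) + T x) := by
      have := hT0 x
      positivity
    calc _ ≤ Es * (rho a b).1 (τ, x) := by gcongr; exact he1 τ hτ x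
      _ ≤ Es * ((1 + 2 * lam) * (rho a b).1 (τ, x) + T x) := by
        gcongr
        nlinarith [hT0 x, mul_nonneg hlam h2]
      _ ≤ _ := le_mul_of_one_le_left h3 (by linarith [norm_nonneg x])
  have hr : ∀ τ ∈ Icc s t, ∀ x, |(e * (source a b - algebraMap ℝ Sm lam * mass a b)).1 (τ, x)|
      ≤ Es * ((1 + 2 * lam) * (rho a b).1 (τ, x) + T x) := by
    intro τ hτ x
    rw [mul_apply, abs_mul, abs_of_nonneg (he0 τ x), sub_apply, mul_apply, const_apply]
    have h2 := mass_le_rho a b (τ, x)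
    have h3 := mass_nonneg a b (τ, x)
    refine mul_le_mul (he1 τ hτ x) ?_ (abs_nonneg _) hEs
    refine (abs_sub _ _).trans ?_
    rw [abs_of_nonneg (mul_nonneg hlam h3)]
    nlinarith [hsrc τ hτ x, mul_le_mul_of_nonneg_left h2 hlam]
  have hF := flux (s := s) (t := t) hlaw hst
    (dom := fun τ x => Es * ((1 + 2 * lam) * (rho a b).1 (τ, x) + T x))
    (C := Es * ((1 + 2 * lam) * C + ∫ x, T x))
    (fun τ => (hm.integrable τ).const_mul (Real.exp (-lam * τ)))
    (fun τ _ => hdi τ) ?_ (hJ 0) (hJ 1) hr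
  · have hle : ∫ τ in s..t, ∫ x, (e * (source a b - algebraMap ℝ Sm lam * mass a b)).1 (τ, x)
        ≤ ∫ τ in s..t, Es * ∫ x, T x := by
      refine intervalIntegral.integral_mono_on hst hF.1 intervalIntegrable_const fun τ hτ => ?_
      rw [← integral_const_mul]
      refine integral_mono ((hdi τ).mono' (continuous_space _ _).aestronglyMeasurable
        (Eventually.of_forall (hr τ hτ))) (hT.const_mul _) fun x => ?_
      simp only [mul_apply, sub_apply, const_apply]
      refine (mul_le_mul_of_nonneg_left (?_ : _ ≤ T x) (he0 τ x)).trans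
        (mul_le_mul_of_nonneg_right (he1 τ hτ x) (hT0 x))
      linarith [le_abs_self ((source a b).1 (τ, x)), hsrc τ hτ x]
    rw [← hF.2, intervalIntegral.integral_const, smul_eq_mul] at hle
    change I (e * mass a b) t - I (e * mass a b) s ≤ _ at hle
    rw [hI_mul, hI_mul] at hle
    have h1 : Real.exp (lam * (t - s)) = Real.exp (lam * t) * Es := by
      rw [← Real.exp_add]; congr 1; ring
    have h2 : Real.exp (lam * t) * Real.exp (-lam * t) = 1 := by
      rw [← Real.exp_add, ← Real.exp_zero]; congr 1; ring
    rw [h1]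
    have h3 := mul_le_mul_of_nonneg_left hle (Real.exp_pos (lam * t)).le
    rw [mul_sub, ← mul_assoc, h2] at h3
    nlinarith [h3]
  · intro τ hτ
    rw [integral_const_mul, integral_add ((hρ.integrable τ).const_mul _) hT, integral_const_mul]
    gcongr
    exact hC τ hτ

end Sm

namespace Sm

/-! ### Propagation of the `L²` norm of the time derivative -/

variable {σ : ℝ} {a b : Sm}

/-- `|∂ₜu|²`. -/
def speed (a b : Sm) : Sm := mass (Dt a) (Dt b)

lemma RSol.isS_speed (h : RSol σ a b) : IsS (speed a b) := isS_mass h.isS_dt_re h.isS_dt_im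

lemma source_sub (h : RSol σ a b) {a' b' wa wb : Sm}
    (ha' : Dt a' = Lap b' - (X2 + algebraMap ℝ Sm σ * (a' * a' + b' * b')) * b' - wa)
    (hb' : Dt b' = -(Lap a' - (X2 + algebraMap ℝ Sm σ * (a' * a' + b' * b')) * a') - wb) :
    source (a - a') (b - b') = 2 * (algebraMap ℝ Sm σ * (mass a b - mass a' b')
      * ((b - b') * a' - (a - a') * b')) + 2 * ((a - a') * wa + (b - b') * wb) := by
  simp only [source, map_sub, h.dt_re, h.dt_im, ha', hb', mass, Lap]
  ring

lemma abs_cubic_le {s a b a' b' L : ℝ} (hs : |s| ≤ 1) (h : a ^ 2 + b ^ 2 ≤ L)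
    (h' : a' ^ 2 + b' ^ 2 ≤ L) :
    |2 * (s * (a ^ 2 + b ^ 2 - (a' ^ 2 + b' ^ 2)) * ((b - b') * a' - (a - a') * b'))|
      ≤ 4 * L * ((a - a') ^ 2 + (b - b') ^ 2) := by
  set g := (a - a') ^ 2 + (b - b') ^ 2 with hg
  have hg0 : 0 ≤ g := by positivity
  have hL : 0 ≤ L := le_trans (by positivity) h
  have e1 : (a ^ 2 + b ^ 2 - (a' ^ 2 + b' ^ 2)) ^ 2 ≤ 4 * L * g := by
    have : (a ^ 2 + b ^ 2 - (a' ^ 2 + b' ^ 2)) ^ 2 ≤ ((a + a') ^ 2 + (b + b') ^ 2) * g := by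
      rw [hg]
      nlinarith [sq_nonneg ((a - a') * (b + b') - (b - b') * (a + a'))]
    refine this.trans (mul_le_mul_of_nonneg_right ?_ hg0)
    nlinarith [sq_nonneg (a - a'), sq_nonneg (b - b')]
  have e2 : ((b - b') * a' - (a - a') * b') ^ 2 ≤ L * g := by
    have : ((b - b') * a' - (a - a') * b') ^ 2 ≤ (a' ^ 2 + b' ^ 2) * g := by
      rw [hg]
      nlinarith [sq_nonneg ((b - b') * b' + (a - a') * a')]
    exact this.trans (mul_le_mul_of_nonneg_right h' hg0)
  have e3 : s ^ 2 ≤ 1 := (sq_le_one_iff_abs_le_one s).2 hs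
  refine abs_le_of_sq_le_sq ?_ (by positivity)
  calc _ = 4 * (s ^ 2 * ((a ^ 2 + b ^ 2 - (a' ^ 2 + b' ^ 2)) ^ 2
        * ((b - b') * a' - (a - a') * b') ^ 2)) := by ring
    _ ≤ 4 * (1 * (4 * L * g * (L * g))) := by gcongr
    _ = _ := by ring

lemma abs_inner_le {a b c d k : ℝ} (hk : 0 < k) :
    |2 * (a * c + b * d)| ≤ k * (a ^ 2 + b ^ 2) + (c ^ 2 + d ^ 2) / k := by
  have h : ∀ x y : ℝ, |2 * (x * y)| ≤ k * x ^ 2 + y ^ 2 / k := by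
    intro x y
    have e : k * x ^ 2 + y ^ 2 / k - 2 * (x * y) = (k * x - y) ^ 2 / k := by field_simp; ring
    have e' : k * x ^ 2 + y ^ 2 / k + 2 * (x * y) = (k * x + y) ^ 2 / k := by field_simp; ring
    have p : 0 ≤ (k * x - y) ^ 2 / k := by positivity
    have p' : 0 ≤ (k * x + y) ^ 2 / k := by positivity
    rw [abs_le]; constructor <;> linarith
  have := abs_add_le (2 * (a * c)) (2 * (b * d))
  rw [mul_add]
  refine this.trans ((add_le_add (h a c) (h b d)).trans (le_of_eq ?_))
  ring

lemma rho_sub_le (a b a' b' : Sm) (p : ℝ × E2) :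
    (rho (a - a') (b - b')).1 p ≤ 2 * (rho a b).1 p + 2 * (rho a' b').1 p := by
  have h : ∀ x y : ℝ, (x - y) ^ 2 ≤ 2 * x ^ 2 + 2 * y ^ 2 := fun x y => by
    nlinarith [sq_nonneg (x + y)]
  simp only [rho_apply, mass_apply, grad_apply, map_sub, sub_apply]
  have hx := mul_le_mul_of_nonneg_left (add_le_add (h (a.1 p) (a'.1 p)) (h (b.1 p) (b'.1 p)))
    (sq_nonneg ‖p.2‖)
  linarith [h (a.1 p) (a'.1 p), h (b.1 p) (b'.1 p), h ((Dx 0 a).1 p) ((Dx 0 a').1 p),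
    h ((Dx 1 a).1 p) ((Dx 1 a').1 p), h ((Dx 0 b).1 p) ((Dx 0 b').1 p),
    h ((Dx 1 b).1 p) ((Dx 1 b').1 p)]

lemma I_rho_sub_le {a b a' b' : Sm} (ha : IsS a) (hb : IsS b) (ha' : IsS a') (hb' : IsS b')
    (t : ℝ) : I (rho (a - a') (b - b')) t ≤ 2 * I (rho a b) t + 2 * I (rho a' b') t := by
  rw [← I_ofNat_mul, ← I_ofNat_mul, ← I_add (IsS.ofNat_mul 2 (isS_rho ha hb))
    (IsS.ofNat_mul 2 (isS_rho ha' hb'))]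
  refine I_mono (isS_rho (ha.sub ha') (hb.sub hb')) ((IsS.ofNat_mul 2 (isS_rho ha hb)).add
    (IsS.ofNat_mul 2 (isS_rho ha' hb'))) fun x => ?_
  simpa only [add_apply, mul_apply, two_apply] using rho_sub_le a b a' b' (t, x)

/-- Uniform `ℋ¹` and sup bounds on a time interval. -/
def Bdd (a b : Sm) (X L s t : ℝ) : Prop :=
  (∀ τ ∈ Icc s t, I (rho a b) τ ≤ X) ∧ ∀ τ ∈ Icc s t, ∀ x, (mass a b).1 (τ, x) ≤ L

lemma Bdd.mono {X L s t s' t' : ℝ} (h : Bdd a b X L s t) (hs : s ≤ s') (ht : t' ≤ t) :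
    Bdd a b X L s' t' :=
  ⟨fun τ hτ => h.1 τ (Icc_subset_Icc hs ht hτ), fun τ hτ => h.2 τ (Icc_subset_Icc hs ht hτ)⟩

lemma increment_le_initial (hs : |σ| ≤ 1) (h : RSol σ a b) {s e X L : ℝ} (he : 0 < e)
    (hL : 0 ≤ L) (hB : Bdd a b X L s (s + e)) :
    I (mass (a - timeAff 0 s a) (b - timeAff 0 s b)) (s + e)
      ≤ Real.exp (1 + 4 * L * e) * (e ^ 2 * I (speed a b) s) := by
  set a' := timeAff 0 s a
  set b' := timeAff 0 s b
  have ha' : IsS a' := h.re.timeAff _ _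
  have hb' : IsS b' := h.im.timeAff _ _
  have d1 : Dt a' = Lap b' - (X2 + algebraMap ℝ Sm σ * (a' * a' + b' * b')) * b'
      - timeAff 0 s (Dt a) := by
    rw [Dt_timeAff, h.dt_re]
    simp only [map_sub, map_zero, map_mul, map_add, X2_timeAff, AlgHom.commutes,
      Lap_timeAff, a', b']
    ring
  have d2 : Dt b' = -(Lap a' - (X2 + algebraMap ℝ Sm σ * (a' * a' + b' * b')) * a')
      - timeAff 0 s (Dt b) := by
    rw [Dt_timeAff, h.dt_im]
    simp only [map_sub, map_neg, map_zero, map_mul, map_add, X2_timeAff, AlgHom.commutes,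
      Lap_timeAff, a', b']
    ring
  have hsp := h.isS_speed.integrable s
  have hss : s ∈ Icc s (s + e) := ⟨le_rfl, by linarith⟩
  have key := mass_growth (h.re.sub ha') (h.im.sub hb') (s := s) (t := s + e) (by linarith)
    (C := 4 * X) (lam := 4 * L + 1 / e) (by positivity) (fun τ hτ => ?_)
    (T := fun x => (speed a b).1 (s, x) / (1 / e)) (hsp.div_const _)
    (fun x => div_nonneg (mass_nonneg _ _ _) (by positivity)) (fun τ hτ x => ?_)
  · have z : I (mass (a - a') (b - b')) s = 0 := by
      have : ∀ x, (mass (a - a') (b - b')).1 (s, x) = 0 := fun x => by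
        simp [mass_apply, sub_apply, a', b', timeAff_apply]
      simp [I, this]
    rw [z, integral_div] at key
    refine key.trans (le_of_eq ?_)
    have h1 : (4 * L + 1 / e) * (s + e - s) = 1 + 4 * L * e := by field_simp; ring
    rw [h1, I]
    congr 1
    field_simp
    ring
  · refine (I_rho_sub_le h.re h.im ha' hb' τ).trans ?_
    have e1 : I (rho a' b') τ = I (rho a b) s := by
      rw [rho_timeAff, I_timeAff]; simp
    rw [e1]
    linarith [hB.1 τ hτ, hB.1 s hss]
  · rw [source_sub h d1 d2]
    have m1 := hB.2 τ hτ x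
    have m2 := hB.2 s hss x
    have m3 : (mass a' b').1 (τ, x) = (mass a b).1 (s, x) := by
      rw [mass_timeAff, timeAff_apply]; simp
    rw [← m3] at m2
    rw [mass_apply] at m1 m2
    rw [add_apply]
    refine (abs_add_le _ _).trans ?_
    simp only [mul_apply, add_apply, sub_apply, two_apply, const_apply, mass_apply,
      timeAff_apply]
    have e1 := abs_cubic_le hs m1 m2
    have e2 := abs_inner_le (a := a.1 (τ, x) - a'.1 (τ, x)) (b := b.1 (τ, x) - b'.1 (τ, x))
      (c := (Dt a).1 (s, x)) (d := (Dt b).1 (s, x)) (k := 1 / e) (by positivity)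
    rw [speed, mass_apply]
    simp only [zero_mul, zero_add] at *
    linarith

lemma increment_propagate (hs : |σ| ≤ 1) (h : RSol σ a b) {s t e X L : ℝ} (he : 0 ≤ e)
    (hst : s ≤ t) (hL : 0 ≤ L) (hB : Bdd a b X L s (t + e)) :
    I (mass (timeAff 1 e a - a) (timeAff 1 e b - b)) t
      ≤ Real.exp (4 * L * (t - s)) * I (mass (timeAff 1 e a - a) (timeAff 1 e b - b)) s := by
  have h' := h.shift e
  set a' := timeAff 1 e a
  set b' := timeAff 1 e b
  have key := mass_growth (h'.re.sub h.re) (h'.im.sub h.im) hst (C := 4 * X) (lam := 4 * L)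
    (by positivity) (fun τ hτ => ?_) (T := fun _ => 0) (integrable_zero _ _ _) (fun _ => le_rfl)
    (fun τ hτ x => ?_)
  · simpa using key
  · refine (I_rho_sub_le h'.re h'.im h.re h.im τ).trans ?_
    have e1 : I (rho a' b') τ = I (rho a b) (τ + e) := by
      rw [rho_timeAff, I_timeAff]; simp
    rw [e1]
    linarith [hB.1 τ ⟨hτ.1, by linarith [hτ.2]⟩,
      hB.1 (τ + e) ⟨by linarith [hτ.1], by linarith [hτ.2]⟩]
  · rw [source_sub h' (a' := a) (b' := b) (wa := 0) (wb := 0) (by rw [h.dt_re, sub_zero])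
      (by rw [h.dt_im, sub_zero])]
    have m1 := hB.2 (τ + e) ⟨by linarith [hτ.1], by linarith [hτ.2]⟩ x
    have m2 := hB.2 τ ⟨hτ.1, by linarith [hτ.2]⟩ x
    have m3 : (mass a' b').1 (τ, x) = (mass a b).1 (τ + e, x) := by
      rw [mass_timeAff, timeAff_apply]; simp
    rw [← m3] at m1
    rw [mass_apply] at m1 m2
    simp only [mul_apply, sub_apply, two_apply, const_apply, mass_apply, mul_zero, add_zero]
    exact abs_cubic_le hs m1 m2

end Sm

/-- Fatou's lemma for pointwise limits of nonnegative integrable functions. -/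
lemma integral_le_of_tendsto_of_nonneg {α : Type*} [MeasurableSpace α] {μ : Measure α}
    {f : ℕ → α → ℝ} {g : α → ℝ} {C : ℝ} (hf : ∀ n, Integrable (f n) μ) (h0 : ∀ n x, 0 ≤ f n x)
    (hg : Integrable g μ) (hlim : ∀ x, Tendsto (fun n => f n x) atTop (𝓝 (g x)))
    (hC : ∀ n, ∫ x, f n x ∂μ ≤ C) : ∫ x, g x ∂μ ≤ C := by
  have hg0 : ∀ x, 0 ≤ g x := fun x => ge_of_tendsto' (hlim x) fun n => h0 n x
  have hC0 : 0 ≤ C := (integral_nonneg (h0 0)).trans (hC 0)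
  rw [← ENNReal.ofReal_le_ofReal_iff hC0,
    ofReal_integral_eq_lintegral_ofReal hg (Eventually.of_forall hg0)]
  calc ∫⁻ x, ENNReal.ofReal (g x) ∂μ
      = ∫⁻ x, liminf (fun n => ENNReal.ofReal (f n x)) atTop ∂μ := by
        refine lintegral_congr fun x => ?_
        exact ((ENNReal.tendsto_ofReal (hlim x)).liminf_eq).symm
    _ ≤ liminf (fun n => ∫⁻ x, ENNReal.ofReal (f n x) ∂μ) atTop :=
        lintegral_liminf_le' fun n => (hf n).aemeasurable.ennreal_ofReal
    _ ≤ ENNReal.ofReal C := by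
        refine liminf_le_of_frequently_le' (Frequently.of_forall fun n => ?_)
        rw [← ofReal_integral_eq_lintegral_ofReal (hf n) (Eventually.of_forall (h0 n))]
        exact ENNReal.ofReal_le_ofReal (hC n)

namespace Sm

variable {σ : ℝ} {a b : Sm}

lemma tendsto_difference_quotient (F : Sm) (t : ℝ) (x : E2) {e : ℕ → ℝ} (he : ∀ n, 0 < e n)
    (hlim : Tendsto e atTop (𝓝 0)) :
    Tendsto (fun n => (e n)⁻¹ * (F.1 (t, x) - F.1 (t - e n, x))) atTop (𝓝 ((Dt F).1 (t, x))) := by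
  have h := (F.hasDerivAt_time t x).tendsto_slope
  have h2 : Tendsto (fun n => t - e n) atTop (𝓝[≠] t) := by
    refine tendsto_nhdsWithin_iff.2 ⟨by simpa using hlim.const_sub t,
      Eventually.of_forall fun n => ?_⟩
    have := he n
    simp only [mem_compl_iff, mem_singleton_iff]
    linarith
  refine (h.comp h2).congr fun n => ?_
  have := (he n).ne'
  simp only [Function.comp, slope_def_field]
  rw [show t - e n - t = -(e n) by ring, ← div_eq_inv_mul, div_neg, ← neg_div, neg_sub]

lemma speed_le (hs : |σ| ≤ 1) (h : RSol σ a b) {s t X L : ℝ} (hst : s ≤ t)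
    (hL : 0 ≤ L) (hB : Bdd a b X L s t) :
    I (speed a b) t ≤ Real.exp (1 + 4 * L * (t - s)) * I (speed a b) s := by
  have hW : 0 ≤ I (speed a b) s := I_mass_nonneg _ _ _
  rcases hst.eq_or_lt with rfl | hlt
  · exact le_mul_of_one_le_left hW (Real.one_le_exp (by simp))
  set e : ℕ → ℝ := fun n => (t - s) / (n + 1) with he
  have he0 : ∀ n, 0 < e n := fun n => div_pos (by linarith) (by positivity)
  have he1 : ∀ n, e n ≤ t - s := fun n => div_le_self (by linarith)
    (by linarith [n.cast_nonneg (α := ℝ)])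
  have helim : Tendsto e atTop (𝓝 0) :=
    (tendsto_const_div_atTop_nhds_zero_nat (t - s)).comp (tendsto_add_atTop_nat 1) |>.congr
      (fun n => by simp [e])
  let q : ℕ → Sm := fun n => mass (timeAff 1 (e n) a - a) (timeAff 1 (e n) b - b)
  have hq : ∀ n, I (q n) (t - e n)
      ≤ (e n) ^ 2 * (Real.exp (1 + 4 * L * (t - s)) * I (speed a b) s) := by
    intro n
    have hst' : s ≤ t - e n := by linarith [he1 n]
    have h1 := increment_propagate hs h (he0 n).le hst' hL (X := X) (by simpa using hB)
    have h2 := increment_le_initial hs h (s := s) (X := X) (he0 n) hL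
      (hB.mono le_rfl (by linarith [he1 n]))
    have h3 : I (q n) s = I (mass (a - timeAff 0 s a) (b - timeAff 0 s b)) (s + e n) := by
      refine integral_congr_ae (Eventually.of_forall fun x => ?_)
      simp [q, mass_apply, sub_apply, timeAff_apply]
    rw [← h3] at h2
    refine h1.trans ((mul_le_mul_of_nonneg_left h2 (Real.exp_pos _).le).trans (le_of_eq ?_))
    have h4 : Real.exp (1 + 4 * L * (t - s))
        = Real.exp (4 * L * (t - e n - s)) * Real.exp (1 + 4 * L * e n) := by
      rw [← Real.exp_add]; congr 1; ring
    rw [h4]; ring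
  refine integral_le_of_tendsto_of_nonneg (f := fun n x => ((e n) ^ 2)⁻¹ * (q n).1 (t - e n, x))
    (fun n => ?_) (fun n x => ?_) (h.isS_speed.integrable t) (fun x => ?_) (fun n => ?_)
  · exact ((isS_mass ((h.re.timeAff _ _).sub h.re) ((h.im.timeAff _ _).sub h.im)).integrable
      _).const_mul _
  · exact mul_nonneg (by positivity) (mass_nonneg _ _ _)
  · have h1 := tendsto_difference_quotient a t x he0 helim
    have h2 := tendsto_difference_quotient b t x he0 helim
    rw [speed, mass_apply]
    refine ((h1.pow 2).add (h2.pow 2)).congr fun n => ?_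
    simp only [q, mass_apply, sub_apply, timeAff_apply, one_mul, sub_add_cancel, mul_pow,
      inv_pow, mul_add]
  · rw [integral_const_mul, inv_mul_le_iff₀ (pow_pos (he0 n) 2)]
    exact hq n

end Sm

namespace Sm

/-! ### Integrated conservation laws under uniform bounds -/

variable {σ : ℝ} {a b : Sm}

lemma abs_two_mul_le (x y : ℝ) : |2 * (x * y)| ≤ x ^ 2 + y ^ 2 := by
  rw [abs_le]; constructor <;> nlinarith [sq_nonneg (x + y), sq_nonneg (x - y)]

lemma abs_virial_le (a b : Sm) (p : ℝ × E2) :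
    |2 * (virial a b).1 p| ≤ (grad a b).1 p + ‖p.2‖ ^ 2 * (mass a b).1 p := by
  rw [← X2_eq, mass_apply, grad_apply]
  simp only [virial, X2, mul_apply, add_apply, sub_apply]
  have h1 := abs_le.1 (abs_two_mul_le ((X 0).1 p * a.1 p) ((Dx 0 b).1 p))
  have h2 := abs_le.1 (abs_two_mul_le ((X 0).1 p * b.1 p) ((Dx 0 a).1 p))
  have h3 := abs_le.1 (abs_two_mul_le ((X 1).1 p * a.1 p) ((Dx 1 b).1 p))
  have h4 := abs_le.1 (abs_two_mul_le ((X 1).1 p * b.1 p) ((Dx 1 a).1 p))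
  rw [abs_le]
  constructor <;> linarith

lemma sq_dx_le_grad (i : Fin 2) (a b : Sm) (p : ℝ × E2) :
    (Dx i a).1 p ^ 2 + (Dx i b).1 p ^ 2 ≤ (grad a b).1 p := by
  rw [grad_apply]
  fin_cases i <;> simp only [Fin.zero_eta, Fin.mk_one]
  · linarith [sq_nonneg ((Dx 1 a).1 p), sq_nonneg ((Dx 1 b).1 p)]
  · linarith [sq_nonneg ((Dx 0 a).1 p), sq_nonneg ((Dx 0 b).1 p)]

lemma abs_X2_current_le (i : Fin 2) (a b : Sm) (p : ℝ × E2) :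
    |(X2 * current i a b).1 p| ≤ ‖p.2‖ * (rho a b).1 p := by
  have e : (X2 * current i a b).1 p = ‖p.2‖ * (2 * ((‖p.2‖ * a.1 p) * (Dx i b).1 p)
      - 2 * ((‖p.2‖ * b.1 p) * (Dx i a).1 p)) := by
    simp only [current, mul_apply, sub_apply, X2_eq, two_apply]; ring
  rw [e, abs_mul, abs_norm, rho_apply]
  refine mul_le_mul_of_nonneg_left ?_ (norm_nonneg _)
  have h1 := abs_two_mul_le (‖p.2‖ * a.1 p) ((Dx i b).1 p)
  have h2 := abs_two_mul_le (‖p.2‖ * b.1 p) ((Dx i a).1 p)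
  have h3 := sq_dx_le_grad i a b p
  have h4 := mass_nonneg a b p
  have h5 : ‖p.2‖ ^ 2 * (mass a b).1 p = (‖p.2‖ * a.1 p) ^ 2 + (‖p.2‖ * b.1 p) ^ 2 := by
    rw [mass_apply]; ring
  refine (abs_sub _ _).trans ?_
  linarith

lemma abs_energyFlux_le (i : Fin 2) (a b : Sm) (p : ℝ × E2) :
    |(4 * (Dx i a * Dt a + Dx i b * Dt b)).1 p| ≤ 2 * ((rho a b).1 p + (speed a b).1 p) := by
  have h1 := abs_le.1 (abs_two_mul_le ((Dx i a).1 p) ((Dt a).1 p))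
  have h2 := abs_le.1 (abs_two_mul_le ((Dx i b).1 p) ((Dt b).1 p))
  have h3 := sq_dx_le_grad i a b p
  have h4 := mass_nonneg a b p
  have h5 := mul_nonneg (sq_nonneg ‖p.2‖) h4
  simp only [mul_apply, add_apply, four_apply]
  rw [rho_apply, speed, mass_apply (Dt a)]
  rw [abs_le]
  constructor <;> linarith

lemma abs_Eul_le (a : Sm) (p : ℝ × E2) (i : Fin 2) :
    |2 * ((Dx i a).1 p * (Eul a).1 p)|
      ≤ 4 * (‖p.2‖ * ((Dx 0 a).1 p ^ 2 + (Dx 1 a).1 p ^ 2)) := by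
  have e : (Eul a).1 p = p.2 0 * (Dx 0 a).1 p + p.2 1 * (Dx 1 a).1 p := rfl
  have h : ∀ j : Fin 2, |2 * ((Dx i a).1 p * (p.2 j * (Dx j a).1 p))|
      ≤ 2 * (‖p.2‖ * ((Dx 0 a).1 p ^ 2 + (Dx 1 a).1 p ^ 2)) := by
    intro j
    have e2 : 2 * ((Dx i a).1 p * (p.2 j * (Dx j a).1 p))
        = p.2 j * (2 * ((Dx i a).1 p * (Dx j a).1 p)) := by ring
    rw [e2, abs_mul]
    have h1 := abs_two_mul_le ((Dx i a).1 p) ((Dx j a).1 p)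
    have h2 : ∀ k : Fin 2, (Dx k a).1 p ^ 2 ≤ (Dx 0 a).1 p ^ 2 + (Dx 1 a).1 p ^ 2 := by
      intro k
      fin_cases k <;> simp only [Fin.zero_eta, Fin.mk_one]
      · linarith [sq_nonneg ((Dx 1 a).1 p)]
      · linarith [sq_nonneg ((Dx 0 a).1 p)]
    calc _ ≤ ‖p.2‖ * ((Dx i a).1 p ^ 2 + (Dx j a).1 p ^ 2) := by
          gcongr
          exact abs_coord_le _ _
      _ ≤ ‖p.2‖ * (2 * ((Dx 0 a).1 p ^ 2 + (Dx 1 a).1 p ^ 2)) := by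
          gcongr
          linarith [h2 i, h2 j]
      _ = _ := by ring
  rw [e, mul_add, mul_add]
  refine (abs_add_le _ _).trans ?_
  linarith [h 0, h 1]

lemma abs_mul_coord_le (x : E2) (i : Fin 2) {y z : ℝ} (h : |y| ≤ z) : |x i * y| ≤ ‖x‖ * z := by
  rw [abs_mul]
  exact mul_le_mul (abs_coord_le x i) h (abs_nonneg _) (norm_nonneg _)

lemma abs_virialFlux_le (hs : |σ| ≤ 1) (i : Fin 2) (a b : Sm) (p : ℝ × E2) {L : ℝ}
    (hL : (mass a b).1 p ≤ L) :
    |(virialFlux σ i a b).1 p|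
      ≤ (1 + ‖p.2‖) * ((6 + L) * ((rho a b).1 p + (speed a b).1 p)) := by
  have hm := mass_nonneg a b p
  have hg := grad_nonneg a b p
  have hw : 0 ≤ (speed a b).1 p := mass_nonneg _ _ p
  have hN := norm_nonneg p.2
  have hv := mul_nonneg (sq_nonneg ‖p.2‖) hm
  set N := ‖p.2‖
  set m := (mass a b).1 p
  set g := (grad a b).1 p
  set w := (speed a b).1 p
  have hwe : w = (Dt a).1 p ^ 2 + (Dt b).1 p ^ 2 := by simp only [w, speed, mass_apply]
  have hme : m = a.1 p ^ 2 + b.1 p ^ 2 := mass_apply a b p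
  have hge := sq_dx_le_grad i a b p
  have t1 : |p.2 i * (a.1 p * (Dt b).1 p - b.1 p * (Dt a).1 p)| ≤ N * (m + w) := by
    refine abs_mul_coord_le _ _ ?_
    have h1 := abs_le.1 (abs_two_mul_le (a.1 p) ((Dt b).1 p))
    have h2 := abs_le.1 (abs_two_mul_le (b.1 p) ((Dt a).1 p))
    rw [abs_le]
    constructor <;> linarith
  have t2 : |2 * (a.1 p * (Dx i a).1 p + b.1 p * (Dx i b).1 p)| ≤ m + g := by
    have h1 := abs_le.1 (abs_two_mul_le (a.1 p) ((Dx i a).1 p))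
    have h2 := abs_le.1 (abs_two_mul_le (b.1 p) ((Dx i b).1 p))
    rw [abs_le]
    constructor <;> linarith
  have t3 : |2 * ((Dx i a).1 p * (Eul a).1 p + (Dx i b).1 p * (Eul b).1 p)| ≤ 4 * (N * g) := by
    have h1 := abs_Eul_le a p i
    have h2 := abs_Eul_le b p i
    rw [mul_add]
    refine (abs_add_le _ _).trans ((add_le_add h1 h2).trans (le_of_eq ?_))
    simp only [g, grad_apply, N]
    ring
  have t4 : |p.2 i * g| ≤ N * g := abs_mul_coord_le _ _ (abs_of_nonneg hg).le
  have t5 : |p.2 i * (N ^ 2 * m)| ≤ N * (N ^ 2 * m) := abs_mul_coord_le _ _ (abs_of_nonneg hv).le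
  have t6 : |σ / 2 * (p.2 i * (m * m))| ≤ N * (L * m) := by
    rw [abs_mul]
    have h1 : |p.2 i * (m * m)| ≤ N * (L * m) := by
      refine abs_mul_coord_le _ _ ?_
      rw [abs_of_nonneg (mul_nonneg hm hm)]
      gcongr
    have h2 : |σ / 2| ≤ 1 := by
      rw [abs_div, abs_two]; linarith
    calc _ ≤ 1 * |p.2 i * (m * m)| := by gcongr
      _ ≤ _ := by linarith
  have e : (virialFlux σ i a b).1 p = p.2 i * (a.1 p * (Dt b).1 p - b.1 p * (Dt a).1 p)
      + 2 * (a.1 p * (Dx i a).1 p + b.1 p * (Dx i b).1 p)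
      + 2 * ((Dx i a).1 p * (Eul a).1 p + (Dx i b).1 p * (Eul b).1 p) - p.2 i * g
      - p.2 i * (N ^ 2 * m) - σ / 2 * (p.2 i * (m * m)) := by
    simp only [virialFlux, add_apply, sub_apply, mul_apply, const_apply, X_apply, X2_eq, two_apply,
      g, N, m]
  have hρ : (rho a b).1 p = m + g + N ^ 2 * m := rho_apply a b p
  have hL0 : 0 ≤ L := hm.trans hL
  have q1 : 0 ≤ N * (L * m) := by positivity
  have q2 : 0 ≤ N * (L * g) := by positivity
  have q3 : 0 ≤ N * (L * w) := by positivity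
  have q4 : 0 ≤ N * (L * (N ^ 2 * m)) := by positivity
  have q5 : 0 ≤ L * (m + g + N ^ 2 * m + w) := by positivity
  have q6 : 0 ≤ N * m := by positivity
  have q7 : 0 ≤ N * g := by positivity
  have q8 : 0 ≤ N * w := by positivity
  have q9 : 0 ≤ N * (N ^ 2 * m) := by positivity
  rw [e, hρ]
  rw [abs_le] at t1 t2 t3 t4 t5 t6 ⊢
  constructor <;> nlinarith only [t1, t2, t3, t4, t5, t6, q1, q2, q3, q4, q5, q6, q7, q8, q9,
    hm, hg, hw, hv]

lemma energy_apply (p : ℝ × E2) : (energy σ a b).1 p = 2 * (grad a b).1 p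
    + 2 * (‖p.2‖ ^ 2 * (mass a b).1 p) + σ * ((mass a b).1 p * (mass a b).1 p) := by
  simp only [energy, add_apply, mul_apply, const_apply, X2_eq, two_apply]

lemma abs_energy_le (hs : |σ| ≤ 1) (p : ℝ × E2) {L : ℝ} (hL : (mass a b).1 p ≤ L) :
    |(energy σ a b).1 p| ≤ (2 + L) * (rho a b).1 p := by
  have hm := mass_nonneg a b p
  have hg := grad_nonneg a b p
  have hv := mul_nonneg (sq_nonneg ‖p.2‖) hm
  have hL0 : 0 ≤ L := hm.trans hL
  rw [energy_apply, rho_apply]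
  have h1 : |σ * ((mass a b).1 p * (mass a b).1 p)| ≤ L * (mass a b).1 p := by
    rw [abs_mul, abs_of_nonneg (mul_nonneg hm hm)]
    calc _ ≤ 1 * (L * (mass a b).1 p) := by gcongr
      _ = _ := one_mul _
  have q1 := mul_nonneg hL0 hg
  have q2 := mul_nonneg hL0 hv
  rw [abs_le] at h1 ⊢
  constructor <;> nlinarith only [h1, q1, q2, hm, hg, hv]

lemma flux_of_bdd (hs : |σ| ≤ 1) (h : RSol σ a b) {s t X L : ℝ} (hst : s ≤ t)
    (hL : 0 ≤ L) (hB : Bdd a b X L s t) {q J₀ J₁ r : Sm} (hlaw : Dt q = Dx 0 J₀ + Dx 1 J₁ + r)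
    (hq : IsS q)
    (h₀ : ∀ τ ∈ Icc s t, ∀ x, |J₀.1 (τ, x)|
      ≤ (1 + ‖x‖) * ((6 + L) * ((rho a b).1 (τ, x) + (speed a b).1 (τ, x))))
    (h₁ : ∀ τ ∈ Icc s t, ∀ x, |J₁.1 (τ, x)|
      ≤ (1 + ‖x‖) * ((6 + L) * ((rho a b).1 (τ, x) + (speed a b).1 (τ, x))))
    (hr : ∀ τ ∈ Icc s t, ∀ x, |r.1 (τ, x)|
      ≤ (6 + L) * ((rho a b).1 (τ, x) + (speed a b).1 (τ, x))) :
    IntervalIntegrable (I r) volume s t ∧ I q t - I q s = ∫ τ in s..t, I r τ := by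
  have hρ := isS_rho h.re h.im
  refine flux hlaw hst hq.integrable
    (dom := fun τ x => (6 + L) * ((rho a b).1 (τ, x) + (speed a b).1 (τ, x)))
    (C := (6 + L) * (X + Real.exp (1 + 4 * L * (t - s)) * I (speed a b) s))
    (fun τ _ => ((hρ.integrable τ).add (h.isS_speed.integrable τ)).const_mul _) (fun τ hτ => ?_)
    h₀ h₁ hr
  rw [integral_const_mul, integral_add (hρ.integrable τ) (h.isS_speed.integrable τ)]
  have hW : 0 ≤ I (speed a b) s := I_mass_nonneg _ _ _
  gcongr
  · exact hB.1 τ hτ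
  · refine (speed_le hs h hτ.1 hL (hB.mono le_rfl hτ.2)).trans ?_
    gcongr
    exact hτ.2

lemma I_two_mul (F : Sm) (t : ℝ) : I (2 * F) t = 2 * I F t := I_ofNat_mul 2 t

lemma conserved_of_bdd (hs : |σ| ≤ 1) (h : RSol σ a b) {s t X L : ℝ} (hst : s ≤ t)
    (hL : 0 ≤ L) (hB : Bdd a b X L s t) :
    I (mass a b) t = I (mass a b) s ∧ I (energy σ a b) t = I (energy σ a b) s ∧
    (I (X2 * mass a b) t - I (X2 * mass a b) s = ∫ τ in s..t, -(4 * I (virial a b) τ)) ∧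
    (I (virial a b) t - I (virial a b) s
      = ∫ τ in s..t, (4 * I (X2 * mass a b) τ - I (energy σ a b) τ)) := by
  have hm := isS_mass h.re h.im
  have hE := isS_energy (σ := σ) h.re h.im
  have hV := isS_virial h.re h.im
  have hρ0 : ∀ p, 0 ≤ (rho a b).1 p := rho_nonneg a b
  have hw0 : ∀ p, 0 ≤ (speed a b).1 p := mass_nonneg _ _
  have hK : ∀ p, 0 ≤ (6 + L) * ((rho a b).1 p + (speed a b).1 p) := fun p =>
    mul_nonneg (by linarith) (add_nonneg (hρ0 p) (hw0 p))
  have h6 : ∀ p, 6 * ((rho a b).1 p + (speed a b).1 p)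
      ≤ (6 + L) * ((rho a b).1 p + (speed a b).1 p) := fun p =>
    mul_le_mul_of_nonneg_right (by linarith) (add_nonneg (hρ0 p) (hw0 p))
  have hN : ∀ p : ℝ × E2, (6 + L) * ((rho a b).1 p + (speed a b).1 p)
      ≤ (1 + ‖p.2‖) * ((6 + L) * ((rho a b).1 p + (speed a b).1 p)) := fun p =>
    le_mul_of_one_le_left (hK p) (by linarith [norm_nonneg p.2])
  have z : ∀ τ, I (0 : Sm) τ = 0 := fun τ => integral_zero _ _
  refine ⟨?_, ?_, ?_, ?_⟩
  · have := (flux_of_bdd hs h hst hL hB (mass_law h) hm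
      (fun τ _ x => ?_) (fun τ _ x => ?_) (fun τ _ x => by simpa [zero_apply] using hK _)).2
    · simp only [z, intervalIntegral.integral_zero] at this
      linarith
    all_goals
      linarith [abs_current_le 0 a b (τ, x), abs_current_le 1 a b (τ, x),
        h6 (τ, x), hN (τ, x), hρ0 (τ, x), hw0 (τ, x)]
  · have := (flux_of_bdd hs h hst hL hB (energy_law h) hE
      (fun τ _ x => ?_) (fun τ _ x => ?_) (fun τ _ x => by simpa [zero_apply] using hK _)).2
    · simp only [z, intervalIntegral.integral_zero] at this
      linarith
    all_goals
      linarith [abs_energyFlux_le 0 a b (τ, x), abs_energyFlux_le 1 a b (τ, x),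
        h6 (τ, x), hN (τ, x), hρ0 (τ, x), hw0 (τ, x)]
  · have hX : ∀ (i : Fin 2) τ x, |(X2 * current i a b).1 (τ, x)|
        ≤ (1 + ‖x‖) * ((6 + L) * ((rho a b).1 (τ, x) + (speed a b).1 (τ, x))) := fun i τ x => by
      refine (abs_X2_current_le i a b (τ, x)).trans ?_
      have := hρ0 (τ, x)
      refine mul_le_mul (by simp) ?_ this (by positivity)
      linarith [h6 (τ, x), hw0 (τ, x)]
    have := (flux_of_bdd hs h hst hL hB (variance_law h) hm.X2_mul
      (fun τ _ x => hX 0 τ x) (fun τ _ x => hX 1 τ x) (fun τ _ x => ?_)).2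
    · rw [this]
      refine intervalIntegral.integral_congr fun τ _ => ?_
      simp only [I_neg, I_two_mul]
      ring
    · have h1 := abs_virial_le a b (τ, x)
      have h2 := rho_apply a b (τ, x)
      have h3 := mass_nonneg a b (τ, x)
      simp only [neg_apply, mul_apply (2 : Sm), two_apply, abs_neg, abs_mul, abs_two] at h1 ⊢
      linarith [h6 (τ, x), hρ0 (τ, x), hw0 (τ, x)]
  · have := (flux_of_bdd hs h hst hL hB (virial_law h) hV
      (fun τ hτ x => abs_virialFlux_le hs 0 a b (τ, x) (hB.2 τ hτ x))
      (fun τ hτ x => abs_virialFlux_le hs 1 a b (τ, x) (hB.2 τ hτ x)) (fun τ hτ x => ?_)).2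
    · rw [this]
      refine intervalIntegral.integral_congr fun τ _ => ?_
      simp only [I_sub (IsS.ofNat_mul 2 (IsS.ofNat_mul 2 hm.X2_mul)) hE, I_two_mul]
      ring
    · have h1 := abs_energy_le hs (τ, x) (hB.2 τ hτ x)
      have h2 := rho_apply a b (τ, x)
      have h3 := mass_nonneg a b (τ, x)
      have h4 := grad_nonneg a b (τ, x)
      have h5 := mul_nonneg (sq_nonneg ‖x‖) h3
      simp only [sub_apply, mul_apply, two_apply, X2_eq] at h1 h2 ⊢
      refine (abs_sub _ _).trans ?_
      rw [abs_of_nonneg (by positivity)]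
      nlinarith [mul_nonneg hL (hw0 (τ, x)), hw0 (τ, x)]

end Sm

open scoped NNReal

/-! ### Gagliardo–Nirenberg–Sobolev -/

lemma norm_clm_le_add (L : E2 →L[ℝ] ℝ) : ‖L‖ ≤ |L (EuclideanSpace.single 0 1)|
    + |L (EuclideanSpace.single 1 1)| := by
  refine L.opNorm_le_bound (by positivity) fun v => ?_
  have hv : v = v 0 • EuclideanSpace.single 0 (1 : ℝ) + v 1 • EuclideanSpace.single 1 (1 : ℝ) := by
    ext i
    fin_cases i <;> simp
  conv_lhs => rw [hv, map_add, map_smul, map_smul]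
  simp only [smul_eq_mul]
  rw [Real.norm_eq_abs]
  refine (abs_add_le _ _).trans ?_
  rw [abs_mul, abs_mul, add_mul, mul_comm (|L _|), mul_comm (|L _|)]
  gcongr <;> exact Sm.abs_coord_le _ _

lemma exists_lintegral_sobolev_const : ∃ K : ℝ≥0, ∀ u : E2 → ℝ, ContDiff ℝ 1 u →
    HasCompactSupport u → ∫⁻ x, ‖u x‖ₑ ^ (2 : ℝ) ≤ K * (∫⁻ x, ‖fderiv ℝ u x‖ₑ) ^ (2 : ℝ) := by
  have hp : Real.HolderConjugate (Module.finrank ℝ E2) 2 := by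
    rw [finrank_euclideanSpace_fin]
    exact_mod_cast Real.HolderConjugate.two_two
  exact ⟨lintegralPowLePowLIntegralFDerivConst (volume : Measure E2) 2, fun u hu hc =>
    lintegral_pow_le_pow_lintegral_fderiv (volume : Measure E2) hu hc hp⟩

lemma ofReal_integral_norm {f : E2 → ℝ} (hf : Integrable f) (h0 : ∀ x, 0 ≤ f x) :
    ∫⁻ x, ENNReal.ofReal (f x) = ENNReal.ofReal (∫ x, f x) :=
  (ofReal_integral_eq_lintegral_ofReal hf (Eventually.of_forall h0)).symm

lemma exists_sobolev_const : ∃ K : ℝ, 0 ≤ K ∧ ∀ u : E2 → ℝ, ContDiff ℝ 1 u → HasCompactSupport u →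
    ∫ x, u x ^ 2 ≤ K * (∫ x, ‖fderiv ℝ u x‖) ^ 2 := by
  obtain ⟨K, hK⟩ := exists_lintegral_sobolev_const
  refine ⟨K, K.coe_nonneg, fun u hu hc => ?_⟩
  have h := hK u hu hc
  have i1 : Integrable (fun x => u x ^ 2) := by
    simp_rw [sq]
    exact (hu.continuous.mul hu.continuous).integrable_of_hasCompactSupport hc.mul_right
  have i2 : Integrable (fun x => ‖fderiv ℝ u x‖) :=
    ((hu.continuous_fderiv one_ne_zero).integrable_of_hasCompactSupport (hc.fderiv (𝕜 := ℝ))).norm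
  have e1 : ∀ x, ‖u x‖ₑ ^ (2 : ℝ) = ENNReal.ofReal (u x ^ 2) := fun x => by
    rw [← ofReal_norm, ENNReal.ofReal_rpow_of_nonneg (norm_nonneg _) (by norm_num)]
    simp
  have e2 : ∀ x, ‖fderiv ℝ u x‖ₑ = ENNReal.ofReal ‖fderiv ℝ u x‖ := fun x => by simp
  have h0 : 0 ≤ ∫ x, ‖fderiv ℝ u x‖ := integral_nonneg fun _ => norm_nonneg _
  simp only [e1, e2] at h
  rw [ofReal_integral_norm i1 fun _ => sq_nonneg _, ofReal_integral_norm i2 fun _ => norm_nonneg _,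
    ENNReal.ofReal_rpow_of_nonneg h0 zero_le_two, ← ENNReal.ofReal_coe_nnreal,
    ← ENNReal.ofReal_mul K.coe_nonneg, Real.rpow_two] at h
  exact (ENNReal.ofReal_le_ofReal_iff (mul_nonneg K.coe_nonneg (sq_nonneg _))).1 h

namespace Sm

lemma exists_gns_const : ∃ K : ℝ, 0 ≤ K ∧ ∀ (F : Sm), IsS F → ∀ (t : ℝ) (h : E2 → ℝ),
    Integrable h → (∀ x, |(Dx 0 F).1 (t, x)| + |(Dx 1 F).1 (t, x)| ≤ h x) →
    I (F * F) t ≤ K * (∫ x, h x) ^ 2 := by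
  obtain ⟨K, hK, hS⟩ := exists_sobolev_const
  obtain ⟨χ, K', hK', hsm, hcs, hle, hlim, -, hder⟩ := exists_cutoff
  refine ⟨K, hK, fun F hF t h hi hh => ?_⟩
  have hf := (F.contDiff_space t)
  have hf1 : ContDiff ℝ 1 (fun x => F.1 (t, x)) := hf.of_le (by simp)
  have hFi := hF.integrable t
  have hh0 : ∀ x, 0 ≤ h x := fun x => le_trans (by positivity) (hh x)
  have hn : ∀ n, ∫ x, (χ n x * F.1 (t, x)) ^ 2
      ≤ K * ((∫ x, h x) + K' / (n + 1) * ∫ x, |F.1 (t, x)|) ^ 2 := by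
    intro n
    have hu : ContDiff ℝ 1 (fun x => χ n x * F.1 (t, x)) := (hsm n).mul hf1
    have hcu : HasCompactSupport (fun x => χ n x * F.1 (t, x)) := (hcs n).mul_right
    refine (hS _ hu hcu).trans ?_
    have hn0 : 0 ≤ ∫ x, ‖fderiv ℝ (fun x => χ n x * F.1 (t, x)) x‖ :=
      integral_nonneg fun _ => norm_nonneg _
    gcongr
    rw [← integral_const_mul, ← integral_add hi (hFi.abs.const_mul _)]
    refine integral_mono
      ((hu.continuous_fderiv one_ne_zero).integrable_of_hasCompactSupport
        (hcu.fderiv (𝕜 := ℝ))).norm (hi.add (hFi.abs.const_mul _)) fun x => ?_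
    have e := fderiv_fun_mul (((hsm n).differentiable one_ne_zero) x)
      ((hf1.differentiable one_ne_zero) x)
    simp only [e]
    refine (norm_add_le _ _).trans ?_
    rw [norm_smul, norm_smul]
    refine add_le_add ?_ ?_
    · have h1 := norm_clm_le_add (fderiv ℝ (fun y => F.1 (t, y)) x)
      rw [fderiv_space, fderiv_space] at h1
      calc _ ≤ 1 * h x := by
            gcongr
            · exact hle n x
            · exact h1.trans (hh x)
        _ = h x := one_mul _
    · rw [mul_comm, Real.norm_eq_abs]
      gcongr
      exact hder n x
  have l1 : Tendsto (fun n => ∫ x, (χ n x * F.1 (t, x)) ^ 2) atTop (𝓝 (I (F * F) t)) := by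
    refine tendsto_integral_of_dominated_convergence (fun x => (F * F).1 (t, x))
      (fun n => ?_) ((hF.mul hF).integrable t) (fun n => Eventually.of_forall fun x => ?_)
      (Eventually.of_forall fun x => ?_)
    · exact (((hsm n).continuous.mul hf.continuous).pow 2).aestronglyMeasurable
    · rw [mul_apply, Real.norm_of_nonneg (sq_nonneg _), mul_pow, sq (F.1 (t, x))]
      exact mul_le_of_le_one_left (mul_self_nonneg _) ((sq_le_one_iff_abs_le_one _).2 (hle n x))
    · have := ((hlim x).mul_const (F.1 (t, x))).pow 2
      simpa [mul_apply, sq] using this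
  have l2 : Tendsto (fun n : ℕ => K * ((∫ x, h x) + K' / (n + 1) * ∫ x, |F.1 (t, x)|) ^ 2) atTop
      (𝓝 (K * ((∫ x, h x) + 0 * ∫ x, |F.1 (t, x)|) ^ 2)) := by
    refine (((Tendsto.mul_const _ ?_).const_add _).pow 2).const_mul _
    exact (tendsto_const_div_atTop_nhds_zero_nat K').comp (tendsto_add_atTop_nat 1) |>.congr
      (fun n => by simp)
  simpa using le_of_tendsto_of_tendsto' l1 l2 hn

end Sm

namespace Sm

/-! ### Interpolation inequalities -/

lemma abs_le_of_sq_le {w p q ε : ℝ} (hp : 0 ≤ p) (hq : 0 ≤ q) (hε : 0 < ε)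
    (h : w ^ 2 ≤ 4 * p * q) : |w| ≤ ε * p + q / ε := by
  refine abs_le_of_sq_le_sq (h.trans ?_) (by positivity)
  have e : p * q = ε * p * (q / ε) := by field_simp
  nlinarith [sq_nonneg (ε * p - q / ε)]

lemma le_of_forall_sq_le {y K A B : ℝ} (hK : 0 ≤ K) (hA : 0 ≤ A) (hB : 0 ≤ B)
    (h : ∀ ε : ℝ, 0 < ε → y ≤ K * (ε * A + B / ε) ^ 2) : y ≤ 4 * K * (A * B) := by
  have key : ∀ η : ℝ, 0 < η → y ≤ 4 * K * ((A + η) * (B + η)) := by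
    intro η hη
    have hA' : 0 < A + η := by linarith
    have hB' : 0 < B + η := by linarith
    have hsA := Real.sqrt_pos.2 hA'
    have hsB := Real.sqrt_pos.2 hB'
    have eA := Real.sq_sqrt hA'.le
    have eB := Real.sq_sqrt hB'.le
    refine (h (√(B + η) / √(A + η)) (by positivity)).trans ?_
    have h1 : √(B + η) / √(A + η) * A ≤ √(B + η) * √(A + η) := by
      rw [div_mul_eq_mul_div, div_le_iff₀ hsA, mul_assoc, ← sq, eA]
      gcongr
      linarith
    have h2 : B / (√(B + η) / √(A + η)) ≤ √(B + η) * √(A + η) := by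
      rw [div_div_eq_mul_div, div_le_iff₀ hsB, mul_right_comm, ← sq, eB]
      gcongr
      linarith
    calc _ ≤ K * (√(B + η) * √(A + η) + √(B + η) * √(A + η)) ^ 2 := by gcongr
      _ = 4 * K * (√(A + η) ^ 2 * √(B + η) ^ 2) := by ring
      _ = _ := by rw [eA, eB]
  have hc : Tendsto (fun η : ℝ => 4 * K * ((A + η) * (B + η))) (𝓝[>] 0)
      (𝓝 (4 * K * ((A + 0) * (B + 0)))) :=
    ((by fun_prop : Continuous fun η : ℝ => 4 * K * ((A + η) * (B + η))).tendsto 0).mono_left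
      nhdsWithin_le_nhds
  rw [add_zero, add_zero] at hc
  exact ge_of_tendsto hc (eventually_mem_nhdsWithin.mono fun η hη => key η hη)

/-- A constant in the two-dimensional Gagliardo–Nirenberg–Sobolev inequality. -/
def gnsConst : ℝ := exists_gns_const.choose

lemma gnsConst_nonneg : 0 ≤ gnsConst := exists_gns_const.choose_spec.1

lemma gns {F H : Sm} (hF : IsS F) (hH : IsS H) (t : ℝ)
    (h : ∀ x, |(Dx 0 F).1 (t, x)| + |(Dx 1 F).1 (t, x)| ≤ H.1 (t, x)) :
    I (F * F) t ≤ gnsConst * I H t ^ 2 :=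
  exists_gns_const.choose_spec.2 F hF t _ (hH.integrable t) h

variable {σ : ℝ} {a b : Sm}

/-- One directional part of `|∇u|²`. -/
def gradPart (i : Fin 2) (a b : Sm) (p : ℝ × E2) : ℝ := (Dx i a).1 p ^ 2 + (Dx i b).1 p ^ 2

lemma gradPart_nonneg (i : Fin 2) (a b : Sm) (p : ℝ × E2) : 0 ≤ gradPart i a b p := by
  unfold gradPart; positivity

lemma gradPart_add (a b : Sm) (p : ℝ × E2) :
    gradPart 0 a b p + gradPart 1 a b p = (grad a b).1 p := by
  rw [grad_apply, gradPart, gradPart]; ring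

lemma Dx_mass_apply (i : Fin 2) (a b : Sm) (p : ℝ × E2) : (Dx i (mass a b)).1 p
    = 2 * (a.1 p * (Dx i a).1 p + b.1 p * (Dx i b).1 p) := by
  simp only [mass, map_add, Derivation.leibniz, smul_eq_mul, add_apply, mul_apply]
  ring

lemma sq_Dx_mass_le (i : Fin 2) (a b : Sm) (p : ℝ × E2) :
    (Dx i (mass a b)).1 p ^ 2 ≤ 4 * (mass a b).1 p * gradPart i a b p := by
  rw [Dx_mass_apply, mass_apply, gradPart]
  nlinarith [sq_nonneg (a.1 p * (Dx i b).1 p - b.1 p * (Dx i a).1 p)]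

lemma I_comb {F G : Sm} (hF : IsS F) (hG : IsS G) (c d : ℝ) (t : ℝ) :
    I (algebraMap ℝ Sm c * F + algebraMap ℝ Sm d * G) t = c * I F t + d * I G t := by
  rw [I_add (hF.const_mul c) (hG.const_mul d), I_const_mul, I_const_mul]

lemma I_mass_sq_le (ha : IsS a) (hb : IsS b) (t : ℝ) :
    I (mass a b * mass a b) t ≤ 8 * gnsConst * (I (mass a b) t * I (grad a b) t) := by
  have hm := isS_mass ha hb
  have hg := isS_grad ha hb
  have := le_of_forall_sq_le (y := I (mass a b * mass a b) t) gnsConst_nonneg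
    (mul_nonneg zero_le_two (I_mass_nonneg a b t)) (I_grad_nonneg a b t) fun ε hε => by
      have := gns (H := algebraMap ℝ Sm (ε * 2) * mass a b + algebraMap ℝ Sm (1 / ε) * grad a b)
        hm ((hm.const_mul _).add (hg.const_mul _)) t fun x => by
          have h0 := abs_le_of_sq_le (mass_nonneg a b (t, x)) (gradPart_nonneg 0 a b (t, x)) hε
            (sq_Dx_mass_le 0 a b (t, x))
          have h1 := abs_le_of_sq_le (mass_nonneg a b (t, x)) (gradPart_nonneg 1 a b (t, x)) hε
            (sq_Dx_mass_le 1 a b (t, x))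
          rw [add_apply, mul_apply, mul_apply, const_apply, const_apply, ← gradPart_add]
          refine (add_le_add h0 h1).trans (le_of_eq ?_)
          ring
      rw [I_comb hm hg] at this
      refine this.trans (le_of_eq ?_)
      ring
  linarith

lemma I_coord_mass_sq_le (ha : IsS a) (hb : IsS b) (j : Fin 2) (t : ℝ) :
    I (X j * mass a b * (X j * mass a b)) t ≤ 2 * gnsConst * I (mass a b) t ^ 2
      + 16 * gnsConst * (I (X2 * mass a b) t * I (grad a b) t) := by
  have hm := isS_mass ha hb
  have hg := isS_grad ha hb
  have hK := gnsConst_nonneg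
  have := le_of_forall_sq_le (y := I (X j * mass a b * (X j * mass a b)) t
      - 2 * gnsConst * I (mass a b) t ^ 2) (mul_nonneg zero_le_two gnsConst_nonneg)
    (mul_nonneg zero_le_two (I_variance_nonneg a b t)) (I_grad_nonneg a b t) fun ε hε => by
      have := gns (H := mass a b + (algebraMap ℝ Sm (ε * 2) * (X2 * mass a b)
          + algebraMap ℝ Sm (1 / ε) * grad a b))
        (hm.X_mul j) (hm.add ((hm.X2_mul.const_mul _).add (hg.const_mul _))) t fun x => by
          have hi : ∀ i, |x j * (Dx i (mass a b)).1 (t, x)|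
              ≤ ε * (‖x‖ ^ 2 * (mass a b).1 (t, x)) + gradPart i a b (t, x) / ε := fun i => by
            have h0 := mass_nonneg a b (t, x)
            have h1 := gradPart_nonneg i a b (t, x)
            refine abs_le_of_sq_le (by positivity) h1 hε ?_
            have h2 : x j ^ 2 ≤ ‖x‖ ^ 2 := sq_le_sq.2 (by
              rw [abs_norm]; exact abs_coord_le x j)
            calc (x j * (Dx i (mass a b)).1 (t, x)) ^ 2
                = x j ^ 2 * (Dx i (mass a b)).1 (t, x) ^ 2 := by ring
              _ ≤ ‖x‖ ^ 2 * (4 * (mass a b).1 (t, x) * gradPart i a b (t, x)) := by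
                gcongr; exact sq_Dx_mass_le i a b (t, x)
              _ = _ := by ring
          have hd : |(Dx 0 (X j)).1 (t, x)| + |(Dx 1 (X j)).1 (t, x)| ≤ 1 := by
            fin_cases j
            · change |(Dx 0 (X 0)).1 (t, x)| + |(Dx 1 (X 0)).1 (t, x)| ≤ 1
              rw [Dx_X_same, Dx_one_X_zero]
              simp
            · change |(Dx 0 (X 1)).1 (t, x)| + |(Dx 1 (X 1)).1 (t, x)| ≤ 1
              rw [Dx_X_same, Dx_zero_X_one]
              simp
          have hl : ∀ i, |(Dx i (X j * mass a b)).1 (t, x)| ≤ |x j * (Dx i (mass a b)).1 (t, x)|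
              + |(Dx i (X j)).1 (t, x)| * (mass a b).1 (t, x) := fun i => by
            have e : (Dx i (X j * mass a b)).1 (t, x) = x j * (Dx i (mass a b)).1 (t, x)
                + (Dx i (X j)).1 (t, x) * (mass a b).1 (t, x) := by
              simp only [Derivation.leibniz, smul_eq_mul, add_apply, mul_apply, X_apply]
              ring
            rw [e]
            refine (abs_add_le _ _).trans ?_
            rw [abs_mul ((Dx i (X j)).1 (t, x)), abs_of_nonneg (mass_nonneg a b (t, x))]
          have hd' := mul_le_mul_of_nonneg_right hd (mass_nonneg a b (t, x))
          simp only [add_apply, mul_apply, const_apply, ← gradPart_add, X2_eq]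
          have e : ε * 2 * (‖x‖ ^ 2 * (mass a b).1 (t, x))
              + 1 / ε * (gradPart 0 a b (t, x) + gradPart 1 a b (t, x))
              = ε * (‖x‖ ^ 2 * (mass a b).1 (t, x)) + gradPart 0 a b (t, x) / ε
                + (ε * (‖x‖ ^ 2 * (mass a b).1 (t, x)) + gradPart 1 a b (t, x) / ε) := by ring
          rw [e]
          linarith [hl 0, hl 1, hi 0, hi 1]
      rw [I_add hm ((hm.X2_mul.const_mul _).add (hg.const_mul _)), I_comb hm.X2_mul hg] at this
      have e : ε * (2 * I (X2 * mass a b) t) + I (grad a b) t / ε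
          = ε * 2 * I (X2 * mass a b) t + 1 / ε * I (grad a b) t := by ring
      rw [e]
      nlinarith [mul_nonneg hK (sq_nonneg (I (mass a b) t
        - (ε * 2 * I (X2 * mass a b) t + 1 / ε * I (grad a b) t)))]
  linarith

lemma I_X2_mass_sq_le (ha : IsS a) (hb : IsS b) (t : ℝ) :
    I (X2 * (mass a b * mass a b)) t ≤ 4 * gnsConst * I (mass a b) t ^ 2
      + 32 * gnsConst * (I (X2 * mass a b) t * I (grad a b) t) := by
  have hm := isS_mass ha hb
  have e : X2 * (mass a b * mass a b) = X 0 * mass a b * (X 0 * mass a b)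
      + X 1 * mass a b * (X 1 * mass a b) := by
    rw [X2]; ring
  rw [e, I_add ((hm.X_mul 0).mul (hm.X_mul 0)) ((hm.X_mul 1).mul (hm.X_mul 1))]
  linarith [I_coord_mass_sq_le ha hb 0 t, I_coord_mass_sq_le ha hb 1 t]

lemma I_mass_mul_sq_le (ha : IsS a) (hb : IsS b) (t : ℝ) :
    I (mass a b * a * (mass a b * a)) t
      ≤ 18 * gnsConst * (I (mass a b * mass a b) t * I (grad a b) t) := by
  have hm := isS_mass ha hb
  have hg := isS_grad ha hb
  have h2 : 0 ≤ I (mass a b * mass a b) t := I_nonneg fun x => mul_self_nonneg _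
  have := le_of_forall_sq_le (y := I (mass a b * a * (mass a b * a)) t) gnsConst_nonneg
    (mul_nonneg (by norm_num : (0 : ℝ) ≤ 9 / 2) h2) (I_grad_nonneg a b t) fun ε hε => by
      have := gns (H := algebraMap ℝ Sm (ε * (9 / 2)) * (mass a b * mass a b)
          + algebraMap ℝ Sm (1 / ε) * grad a b)
        (hm.mul ha) (((hm.mul hm).const_mul _).add (hg.const_mul _)) t fun x => by
          have hi : ∀ i, |(Dx i (mass a b * a)).1 (t, x)| ≤ ε * (9 / 4 * (mass a b).1 (t, x) ^ 2)
              + gradPart i a b (t, x) / ε := fun i => by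
            refine abs_le_of_sq_le (by positivity) (gradPart_nonneg i a b (t, x)) hε ?_
            simp only [Derivation.leibniz, smul_eq_mul, add_apply, mul_apply, Dx_mass_apply]
            rw [mass_apply, gradPart]
            generalize a.1 (t, x) = a
            generalize b.1 (t, x) = b
            generalize (Dx i _).1 (t, x) = c
            generalize (Dx i _).1 (t, x) = d
            have e : 4 * (9 / 4 * (a ^ 2 + b ^ 2) ^ 2) * (c ^ 2 + d ^ 2)
                - ((a ^ 2 + b ^ 2) * c + a * (2 * (a * c + b * d))) ^ 2
                = (2 * a * b * c - (3 * a ^ 2 + b ^ 2) * d) ^ 2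
                  + 8 * (a ^ 2 + b ^ 2) * b ^ 2 * (c ^ 2 + d ^ 2) := by ring
            have : 0 ≤ 8 * (a ^ 2 + b ^ 2) * b ^ 2 * (c ^ 2 + d ^ 2) := by positivity
            linarith [sq_nonneg (2 * a * b * c - (3 * a ^ 2 + b ^ 2) * d)]
          simp only [add_apply, mul_apply, const_apply, ← gradPart_add]
          refine (add_le_add (hi 0) (hi 1)).trans (le_of_eq ?_)
          ring
      rw [I_comb (hm.mul hm) hg] at this
      refine this.trans (le_of_eq ?_)
      ring
  linarith

lemma mass_swap (a b : Sm) : mass b a = mass a b := by rw [mass, mass, add_comm]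

lemma grad_swap (a b : Sm) : grad b a = grad a b := by rw [grad, grad, add_comm]

lemma I_mass_cube_le (ha : IsS a) (hb : IsS b) (t : ℝ) :
    I (mass a b * (mass a b * mass a b)) t
      ≤ 36 * gnsConst * (I (mass a b * mass a b) t * I (grad a b) t) := by
  have hm := isS_mass ha hb
  have e : mass a b * (mass a b * mass a b) = mass a b * a * (mass a b * a)
      + mass a b * b * (mass a b * b) := by
    rw [mass]; ring
  have h := I_mass_mul_sq_le hb ha t
  rw [mass_swap, grad_swap] at h
  rw [e, I_add ((hm.mul ha).mul (hm.mul ha)) ((hm.mul hb).mul (hm.mul hb))]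
  linarith [I_mass_mul_sq_le ha hb t]

/-! ### Local bounds for the weighted energy -/

lemma le_two_mul_of_half {ι : Type*} {f : ι → ℝ} {s : Set ι} {c C : ℝ} (hC : ∀ i ∈ s, f i ≤ C)
    (h : ∀ S, (∀ i ∈ s, f i ≤ S) → ∀ i ∈ s, f i ≤ c + S / 2) : ∀ i ∈ s, f i ≤ 2 * c := by
  intro i hi
  have hb : BddAbove (f '' s) := ⟨C, by rintro _ ⟨j, hj, rfl⟩; exact hC j hj⟩
  have h1 := h (sSup (f '' s)) fun j hj => le_csSup hb ⟨j, hj, rfl⟩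
  have h2 : sSup (f '' s) ≤ c + sSup (f '' s) / 2 :=
    csSup_le ⟨_, i, hi, rfl⟩ (by rintro _ ⟨j, hj, rfl⟩; exact h1 j hj)
  linarith [h1 i hi]

lemma abs_I_virial_le (ha : IsS a) (hb : IsS b) (t : ℝ) : |I (virial a b) t| ≤ I (rho a b) t := by
  refine abs_I_le (isS_rho ha hb) fun x => ?_
  have := abs_virial_le a b (t, x)
  rw [abs_mul, abs_two] at this
  rw [rho_apply]
  linarith [mass_nonneg a b (t, x), abs_nonneg ((virial a b).1 (t, x))]

lemma exists_variance_bound (hs : |σ| ≤ 1) (h : RSol σ a b) {s t X L e n : ℝ} (hlen : t - s ≤ 1 / 8)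
    (hL : 0 ≤ L) (hB : Bdd a b X L s t) {τ₀ : ℝ} (hτ₀ : τ₀ ∈ Icc s t)
    (hn : I (rho a b) τ₀ ≤ n) (he : |I (energy σ a b) τ₀| ≤ e) :
    ∀ τ ∈ Icc s t, I (mass a b) τ = I (mass a b) τ₀ ∧ I (energy σ a b) τ = I (energy σ a b) τ₀ ∧
      I (X2 * mass a b) τ ≤ 2 * n + e := by
  set E := I (energy σ a b) τ₀ with hE
  have hcons : ∀ τ ∈ Icc s t, I (mass a b) τ = I (mass a b) τ₀ ∧ I (energy σ a b) τ = E ∧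
      (I (X2 * mass a b) τ - I (X2 * mass a b) τ₀ = ∫ r in τ₀..τ, -(4 * I (virial a b) r)) ∧
      (I (virial a b) τ - I (virial a b) τ₀
        = ∫ r in τ₀..τ, (4 * I (X2 * mass a b) r - I (energy σ a b) r)) := by
    intro τ hτ
    rcases le_total τ₀ τ with hle | hle
    · exact conserved_of_bdd hs h hle hL (hB.mono hτ₀.1 hτ.2)
    · obtain ⟨h1, h2, h3, h4⟩ := conserved_of_bdd hs h hle hL (hB.mono hτ.1 hτ₀.2)
      refine ⟨h1.symm, h2.symm, ?_, ?_⟩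
      · rw [intervalIntegral.integral_symm, ← h3]; ring
      · rw [intervalIntegral.integral_symm, ← h4]; ring
  have hrho : ∀ τ, I (rho a b) τ = I (mass a b) τ + I (grad a b) τ + I (X2 * mass a b) τ :=
    I_rho h.re h.im
  have hV : ∀ τ, 0 ≤ I (X2 * mass a b) τ ∧ I (X2 * mass a b) τ ≤ I (rho a b) τ := fun τ =>
    ⟨I_variance_nonneg a b τ, by
      linarith [hrho τ, I_mass_nonneg a b τ, I_grad_nonneg a b τ]⟩
  have key : ∀ τ ∈ Icc s t, max |I (X2 * mass a b) τ - E / 4| |I (virial a b) τ|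
      ≤ 2 * (n + e / 4) := by
    have he0 : 0 ≤ e := (abs_nonneg _).trans he
    have hE4 : |E / 4| ≤ e / 4 := by rw [abs_div, abs_of_pos (by norm_num : (0 : ℝ) < 4)]; linarith
    refine le_two_mul_of_half (C := X + e / 4) (fun τ hτ => max_le ?_ ?_) fun S hS τ hτ => ?_
    · have := hB.1 τ hτ
      refine (abs_sub _ _).trans ?_
      rw [abs_of_nonneg (hV τ).1]
      linarith [(hV τ).2]
    · linarith [abs_I_virial_le h.re h.im τ, hB.1 τ hτ]
    · have hsub : ∀ r ∈ uIoc τ₀ τ, r ∈ Icc s t := fun r hr =>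
        (uIcc_subset_Icc hτ₀ hτ) (uIoc_subset_uIcc hr)
      have hlen' : |τ - τ₀| ≤ 1 / 8 := by
        rw [abs_le]; constructor <;> linarith [hτ.1, hτ.2, hτ₀.1, hτ₀.2]
      have hS0 : 0 ≤ S := (abs_nonneg _).trans ((le_max_right _ _).trans (hS τ hτ))
      obtain ⟨-, -, h3, h4⟩ := hcons τ hτ
      have i3 : |∫ r in τ₀..τ, -(4 * I (virial a b) r)| ≤ 4 * S * |τ - τ₀| := by
        rw [← Real.norm_eq_abs]
        refine intervalIntegral.norm_integral_le_of_norm_le_const fun r hr => ?_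
        · rw [Real.norm_eq_abs, abs_neg, abs_mul, abs_of_pos (by norm_num : (0 : ℝ) < 4)]
          linarith [(le_max_right _ _).trans (hS r (hsub r hr))]
      have i4 : |∫ r in τ₀..τ, (4 * I (X2 * mass a b) r - I (energy σ a b) r)|
          ≤ 4 * S * |τ - τ₀| := by
        rw [← Real.norm_eq_abs]
        refine intervalIntegral.norm_integral_le_of_norm_le_const fun r hr => ?_
        · have e1 : 4 * I (X2 * mass a b) r - I (energy σ a b) r
              = 4 * (I (X2 * mass a b) r - E / 4) := by
            rw [(hcons r (hsub r hr)).2.1]; ring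
          rw [Real.norm_eq_abs, e1, abs_mul, abs_of_pos (by norm_num : (0 : ℝ) < 4)]
          linarith [(le_max_left _ _).trans (hS r (hsub r hr))]
      have hb : 4 * S * |τ - τ₀| ≤ S / 2 := by nlinarith
      rw [← h3] at i3
      rw [← h4] at i4
      have v0 : |I (X2 * mass a b) τ₀ - E / 4| ≤ n + e / 4 := by
        refine (abs_sub _ _).trans ?_
        rw [abs_of_nonneg (hV τ₀).1]
        linarith [(hV τ₀).2]
      refine max_le ?_ ?_
      · have := abs_add_le (I (X2 * mass a b) τ - I (X2 * mass a b) τ₀)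
          (I (X2 * mass a b) τ₀ - E / 4)
        rw [sub_add_sub_cancel] at this
        linarith
      · have := abs_add_le (I (virial a b) τ - I (virial a b) τ₀) (I (virial a b) τ₀)
        rw [sub_add_cancel] at this
        linarith [abs_I_virial_le h.re h.im τ₀]
  intro τ hτ
  refine ⟨(hcons τ hτ).1, (hcons τ hτ).2.1, ?_⟩
  have h1 := (le_abs_self _).trans ((le_max_left _ _).trans (key τ hτ))
  linarith [le_abs_self E, abs_nonneg E]

lemma exists_mass_bound (a b : Sm) (α β R : ℝ) :
    ∃ μ, 0 ≤ μ ∧ ∀ τ ∈ Icc α β, ∀ x : E2, ‖x‖ ≤ R → (mass a b).1 (τ, x) ≤ μ := by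
  obtain ⟨μ, hμ⟩ :=
    (isCompact_Icc.prod (isCompact_closedBall (0 : E2) R)).exists_bound_of_continuousOn
    (mass a b).continuous.continuousOn (s := Icc α β ×ˢ Metric.closedBall (0 : E2) R)
  refine ⟨max μ 0, le_max_right _ _, fun τ hτ x hx => (le_abs_self _).trans
    ((hμ (τ, x) ⟨hτ, by simpa using hx⟩).trans (le_max_left _ _))⟩

/-- Bounds for mass, energy and virial identities, propagated from one time. -/
lemma exists_rho_bound (hs : |σ| ≤ 1) (h : RSol σ a b) (α β n : ℝ) (hn0 : 0 ≤ n) :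
    ∃ B, 0 ≤ B ∧ ∀ s t X L τ₀ : ℝ, α ≤ s → t ≤ β → t - s ≤ 1 / 8 → 0 ≤ L → Bdd a b X L s t →
      τ₀ ∈ Icc s t → I (rho a b) τ₀ ≤ n → (∀ x, (mass a b).1 (τ₀, x) ≤ n) →
      ∀ τ ∈ Icc s t, I (rho a b) τ ≤ B := by
  set e := (2 + n) * n with he
  have hK := gnsConst_nonneg
  have he0 : 0 ≤ e := by positivity
  obtain ⟨μ, hμ0, hμ⟩ := exists_mass_bound a b α β (√(1 + 32 * gnsConst * (2 * n + e)))
  refine ⟨n + (2 * n + e) + (e + μ * n + 4 * gnsConst * n ^ 2), by positivity,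
    fun s t X L τ₀ hα hβ hlen hL hB hτ₀ hρ hm τ hτ => ?_⟩
  have hE : |I (energy σ a b) τ₀| ≤ e := by
    refine (abs_I_le ((isS_rho h.re h.im).const_mul (2 + n)) fun x => ?_).trans ?_
    · rw [mul_apply, const_apply]
      exact abs_energy_le hs _ (hm x)
    · rw [I_const_mul, he]
      gcongr
  obtain ⟨hM, hEn, hV⟩ := exists_variance_bound hs h hlen hL hB hτ₀ hρ hE τ hτ
  have hM' : I (mass a b) τ ≤ n := by
    rw [hM]
    linarith [I_rho h.re h.im τ₀, I_grad_nonneg a b τ₀, I_variance_nonneg a b τ₀]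
  have hmS := isS_mass h.re h.im
  set R2 := 1 + 32 * gnsConst * (2 * n + e) with hR2
  have hR2p : 0 < R2 := by positivity
  have hQ : I (mass a b * mass a b) τ ≤ μ * I (mass a b) τ
      + 1 / R2 * I (X2 * (mass a b * mass a b)) τ := by
    rw [← I_comb hmS (hmS.mul hmS).X2_mul]
    refine I_mono (hmS.mul hmS) ((hmS.const_mul _).add ((hmS.mul hmS).X2_mul.const_mul _))
      fun x => ?_
    simp only [add_apply, mul_apply, const_apply, X2_eq]
    have m0 := mass_nonneg a b (τ, x)
    rcases le_total ‖x‖ (√R2) with hx | hx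
    · have := mul_le_mul_of_nonneg_right (hμ τ ⟨hα.trans hτ.1, hτ.2.trans hβ⟩ x hx) m0
      have h2 : 0 ≤ 1 / R2 * (‖x‖ ^ 2 * ((mass a b).1 (τ, x) * (mass a b).1 (τ, x))) := by
        positivity
      linarith
    · have h1 : 1 ≤ 1 / R2 * ‖x‖ ^ 2 := by
        rw [one_div, ← div_eq_inv_mul, one_le_div hR2p]
        exact (Real.sqrt_le_left (norm_nonneg x)).1 hx
      have h2 := mul_le_mul_of_nonneg_right h1 (mul_nonneg m0 m0)
      have h3 : 0 ≤ μ * (mass a b).1 (τ, x) := by positivity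
      linarith
  have hX := I_X2_mass_sq_le h.re h.im τ
  have g0 := I_grad_nonneg a b τ
  have m0 := I_mass_nonneg a b τ
  have hX' : 1 / R2 * I (X2 * (mass a b * mass a b)) τ ≤ 4 * gnsConst * n ^ 2 + I (grad a b) τ := by
    rw [one_div, ← div_eq_inv_mul, div_le_iff₀ hR2p]
    have h1 : I (mass a b) τ ^ 2 ≤ n ^ 2 := by gcongr
    have h2 : I (X2 * mass a b) τ * I (grad a b) τ ≤ (2 * n + e) * I (grad a b) τ := by gcongr
    have h3 : 4 * gnsConst * I (mass a b) τ ^ 2 ≤ 4 * gnsConst * n ^ 2 := by gcongr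
    have h4 : 32 * gnsConst * (I (X2 * mass a b) τ * I (grad a b) τ)
        ≤ 32 * gnsConst * ((2 * n + e) * I (grad a b) τ) := by gcongr
    have h5 : 1 ≤ R2 := by
      have : 0 ≤ 32 * gnsConst * (2 * n + e) := by positivity
      linarith
    have h6 : 4 * gnsConst * n ^ 2 * 1 ≤ 4 * gnsConst * n ^ 2 * R2 := by gcongr
    have h7 : I (grad a b) τ * R2 = I (grad a b) τ
        + 32 * gnsConst * ((2 * n + e) * I (grad a b) τ) := by rw [hR2]; ring
    linarith
  have hen : I (energy σ a b) τ = 2 * I (grad a b) τ + 2 * I (X2 * mass a b) τ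
      + σ * I (mass a b * mass a b) τ := by
    have hg := isS_grad h.re h.im
    rw [energy, I_add ((hg.ofNat_mul 2).add (hmS.X2_mul.ofNat_mul 2)) ((hmS.mul hmS).const_mul σ),
      I_add (hg.ofNat_mul 2) (hmS.X2_mul.ofNat_mul 2), I_two_mul, I_two_mul, I_const_mul]
  have hQ0 : 0 ≤ I (mass a b * mass a b) τ := I_nonneg fun x => mul_self_nonneg _
  have hσ : -I (mass a b * mass a b) τ ≤ σ * I (mass a b * mass a b) τ := by
    nlinarith [neg_abs_le σ]
  have hE' := (abs_le.1 hE).2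
  have hv0 := I_variance_nonneg a b τ
  have hμM : μ * I (mass a b) τ ≤ μ * n := by gcongr
  rw [I_rho h.re h.im]
  linarith

end Sm

namespace Sm

/-! ### The Laplacian is controlled by the time derivative -/

lemma I_dx {F : Sm} (hF : IsS F) (i : Fin 2) (t : ℝ) : I (Dx i F) t = 0 := by
  have h := integral_mul_fderiv_eq_neg_fderiv_mul_of_integrable (μ := (volume : Measure E2))
    (f := fun _ => (1 : ℝ)) (g := fun x => F.1 (t, x)) (v := EuclideanSpace.single i 1)
    (by simp) (by simpa only [one_mul, fderiv_space] using (hF.dx i).integrable t)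
    (by simpa only [one_mul] using hF.integrable t) (fun x _ => differentiableAt_const _)
    (fun x _ => (F.contDiff_space t).differentiable (by simp) x)
  change ∫ x, (Dx i F).1 (t, x) = 0
  simpa only [one_mul, fderiv_space, fderiv_fun_const, Pi.zero_apply, _root_.zero_apply, zero_mul,
    integral_zero, neg_zero] using h

set_option linter.unusedSimpArgs false in
lemma lap_sq_identity (F : Sm) : Lap F * Lap F = (Lap F - X2 * F) * (Lap F - X2 * F) + 4 * (F * F)
    + 2 * (Dx 0 (X2 * (F * Dx 0 F) - X 0 * (F * F)) + Dx 1 (X2 * (F * Dx 1 F) - X 1 * (F * F)))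
    - (X2 * F * (X2 * F) + 2 * (X2 * (Dx 0 F * Dx 0 F + Dx 1 F * Dx 1 F))) := by
  simp only [Lap, X2, map_add, map_sub, Derivation.leibniz, smul_eq_mul, Dx_X_same, Dx_zero_X_one,
    Dx_one_X_zero]
  ring

lemma I_lap_sq_le {F : Sm} (hF : IsS F) (t : ℝ) :
    I (Lap F * Lap F) t ≤ I ((Lap F - X2 * F) * (Lap F - X2 * F)) t + 4 * I (F * F) t := by
  have hL := hF.lap.sub hF.X2_mul
  have hV : ∀ i, IsS (X2 * (F * Dx i F) - X i * (F * F)) := fun i =>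
    (hF.mul (hF.dx i)).X2_mul.sub ((hF.mul hF).X_mul i)
  have hR : IsS (X2 * F * (X2 * F) + 2 * (X2 * (Dx 0 F * Dx 0 F + Dx 1 F * Dx 1 F))) :=
    (hF.X2_mul.mul hF.X2_mul).add
      ((((hF.dx 0).mul (hF.dx 0)).add ((hF.dx 1).mul (hF.dx 1))).X2_mul.ofNat_mul 2)
  have hR0 : 0 ≤ I (X2 * F * (X2 * F)
      + 2 * (X2 * (Dx 0 F * Dx 0 F + Dx 1 F * Dx 1 F))) t := I_nonneg fun x => by
    simp only [add_apply, mul_apply, two_apply, X2_eq]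
    simp only [← sq]
    positivity
  rw [lap_sq_identity F,
    I_sub (((hL.mul hL).add ((hF.mul hF).ofNat_mul 4)).add
      ((((hV 0).dx 0).add ((hV 1).dx 1)).ofNat_mul 2)) hR,
    I_add ((hL.mul hL).add ((hF.mul hF).ofNat_mul 4))
      ((((hV 0).dx 0).add ((hV 1).dx 1)).ofNat_mul 2),
    I_add (hL.mul hL) ((hF.mul hF).ofNat_mul 4), I_two_mul,
    I_add ((hV 0).dx 0) ((hV 1).dx 1), I_dx (hV 0), I_dx (hV 1), I_ofNat_mul]
  linarith

variable {σ : ℝ} {a b : Sm}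

/-- `|Δu|²`. -/
def lapSq (a b : Sm) : Sm := Lap a * Lap a + Lap b * Lap b

lemma I_lapSq_le (hs : |σ| ≤ 1) (h : RSol σ a b) (t : ℝ) :
    I (lapSq a b) t ≤ 2 * I (speed a b) t + 2 * I (mass a b * (mass a b * mass a b)) t
      + 4 * I (mass a b) t := by
  have ha := h.re
  have hb := h.im
  have hm := isS_mass ha hb
  have hLa := ha.lap.sub ha.X2_mul
  have hLb := hb.lap.sub hb.X2_mul
  have h1 : I ((Lap a - X2 * a) * (Lap a - X2 * a) + (Lap b - X2 * b) * (Lap b - X2 * b)) t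
      ≤ I (2 * speed a b + 2 * (mass a b * (mass a b * mass a b))) t := by
    refine I_mono ((hLa.mul hLa).add (hLb.mul hLb))
      ((h.isS_speed.ofNat_mul 2).add ((hm.mul (hm.mul hm)).ofNat_mul 2)) fun x => ?_
    have e1 : Lap a - X2 * a = -Dt b + algebraMap ℝ Sm σ * (mass a b * a) := by
      rw [h.dt_im, mass]; ring
    have e2 : Lap b - X2 * b = Dt a + algebraMap ℝ Sm σ * (mass a b * b) := by
      rw [h.dt_re, mass]; ring
    rw [e1, e2]
    simp only [add_apply, mul_apply, neg_apply, const_apply, two_apply, speed, mass_apply]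
    generalize a.1 (t, x) = p
    generalize b.1 (t, x) = q
    generalize (Dt a).1 (t, x) = r
    generalize (Dt b).1 (t, x) = s
    have hσ : σ ^ 2 ≤ 1 := (sq_le_one_iff_abs_le_one σ).2 hs
    have h3 : 0 ≤ (p ^ 2 + q ^ 2) ^ 3 := by positivity
    have h4 := mul_le_mul_of_nonneg_right hσ h3
    nlinarith [sq_nonneg (-s - σ * ((p ^ 2 + q ^ 2) * p)),
      sq_nonneg (r - σ * ((p ^ 2 + q ^ 2) * q))]
  rw [I_add (hLa.mul hLa) (hLb.mul hLb), I_add (h.isS_speed.ofNat_mul 2)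
    ((hm.mul (hm.mul hm)).ofNat_mul 2), I_two_mul, I_two_mul] at h1
  have h2 : I (mass a b) t = I (a * a) t + I (b * b) t := I_add (ha.mul ha) (hb.mul hb) t
  rw [lapSq, I_add (ha.lap.mul ha.lap) (hb.lap.mul hb.lap)]
  linarith [I_lap_sq_le ha t, I_lap_sq_le hb t]

lemma I_lapSq_le_of_rho_le (hs : |σ| ≤ 1) (h : RSol σ a b) {t B : ℝ} (hB : I (rho a b) t ≤ B) :
    I (lapSq a b) t ≤ 2 * I (speed a b) t + (576 * gnsConst ^ 2 * B ^ 3 + 4 * B) := by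
  have hK := gnsConst_nonneg
  have h1 := I_rho h.re h.im t
  have m0 := I_mass_nonneg a b t
  have g0 := I_grad_nonneg a b t
  have v0 := I_variance_nonneg a b t
  have hM : I (mass a b) t ≤ B := by linarith
  have hG : I (grad a b) t ≤ B := by linarith
  have hB0 : 0 ≤ B := m0.trans hM
  have h2 : I (mass a b * mass a b) t ≤ 8 * gnsConst * (B * B) :=
    (I_mass_sq_le h.re h.im t).trans (by gcongr)
  have h3 : I (mass a b * (mass a b * mass a b)) t
      ≤ 36 * gnsConst * (8 * gnsConst * (B * B) * B) :=
    (I_mass_cube_le h.re h.im t).trans (by gcongr)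
  have := I_lapSq_le hs h t
  nlinarith

end Sm

/-! ### A logarithmic Sobolev embedding -/

lemma hasDerivAt_log_ratio {L : ℝ} (hL : 0 ≤ L) (y : ℝ) :
    HasDerivAt (fun y : ℝ => 1 / 2 * (Real.log (1 + y ^ 2) - Real.log (L + 1 + y ^ 2)))
      (y * (L / ((1 + y ^ 2) * (L + 1 + y ^ 2)))) y := by
  have p1 : 1 + y ^ 2 ≠ 0 := by positivity
  have p2 : L + 1 + y ^ 2 ≠ 0 := by positivity
  have hd : ∀ c : ℝ, HasDerivAt (fun y : ℝ => c + y ^ 2) (2 * y) y := fun c => by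
    simpa using (hasDerivAt_pow 2 y).const_add c
  convert! (((hd 1).log p1).sub ((hd (L + 1)).log p2)).const_mul (1 / 2 : ℝ) using 1
  field_simp
  ring

lemma tendsto_log_ratio {L : ℝ} (hL : 0 ≤ L) :
    Tendsto (fun y : ℝ => 1 / 2 * (Real.log (1 + y ^ 2) - Real.log (L + 1 + y ^ 2)))
      atTop (𝓝 0) := by
  have h1 : Tendsto (fun y : ℝ => L + 1 + y ^ 2) atTop atTop :=
    tendsto_atTop_add_const_left _ _ (tendsto_pow_atTop two_ne_zero)
  have h2 : Tendsto (fun y : ℝ => 1 - L / (L + 1 + y ^ 2)) atTop (𝓝 (1 - 0)) :=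
    (h1.const_div_atTop L).const_sub 1
  rw [sub_zero] at h2
  have h3 := (h2.log one_ne_zero).const_mul (1 / 2 : ℝ)
  rw [Real.log_one, mul_zero] at h3
  refine h3.congr fun y => ?_
  rw [← Real.log_div (by positivity) (by positivity)]
  congr 2
  field_simp
  ring

lemma log_weight_nonneg {L : ℝ} (hL : 0 ≤ L) (y : ℝ) :
    0 ≤ L / ((1 + y ^ 2) * (L + 1 + y ^ 2)) := by positivity

lemma integrable_log_weight {L : ℝ} (hL : 0 ≤ L) :
    Integrable (fun x : E2 => L / ((1 + ‖x‖ ^ 2) * (L + 1 + ‖x‖ ^ 2))) := by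
  refine (integrable_fun_norm_addHaar (volume : Measure E2)
    (f := fun y => L / ((1 + y ^ 2) * (L + 1 + y ^ 2)))).2 ?_
  rw [finrank_euclideanSpace_fin]
  simp only [Nat.add_one_sub_one, pow_one, smul_eq_mul]
  exact integrableOn_Ioi_deriv_of_nonneg' (fun x _ => hasDerivAt_log_ratio hL x)
    (fun x hx => mul_nonneg (le_of_lt hx) (log_weight_nonneg hL x)) (tendsto_log_ratio hL)

lemma integral_log_weight {L : ℝ} (hL : 0 ≤ L) :
    ∫ x : E2, L / ((1 + ‖x‖ ^ 2) * (L + 1 + ‖x‖ ^ 2))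
      = volume.real (Metric.ball (0 : E2) 1) * Real.log (L + 1) := by
  rw [integral_fun_norm_addHaar (volume : Measure E2)
    (fun y => L / ((1 + y ^ 2) * (L + 1 + y ^ 2))), finrank_euclideanSpace_fin]
  simp only [Nat.add_one_sub_one, pow_one, smul_eq_mul, nsmul_eq_mul]
  rw [integral_Ioi_of_hasDerivAt_of_nonneg' (fun x _ => hasDerivAt_log_ratio hL x)
    (fun x hx => mul_nonneg (le_of_lt hx) (log_weight_nonneg hL x)) (tendsto_log_ratio hL)]
  simp
  ring

section Fourier

open scoped FourierTransform LineDeriv SchwartzMap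

lemma norm_le_integral_norm_fourier (φ : 𝓢(E2, ℂ)) (x : E2) : ‖φ x‖ ≤ ∫ ξ, ‖𝓕 φ ξ‖ := by
  have h : φ x = 𝓕⁻ (𝓕 φ) x := by rw [FourierTransform.fourierInv_fourier_eq]
  rw [h, SchwartzMap.fourierInv_coe, Real.fourierInv_eq]
  refine (norm_integral_le_integral_norm _).trans (le_of_eq ?_)
  simp

/-- The partial derivatives of a Schwartz function. -/
def schwartzDx (i : Fin 2) (φ : 𝓢(E2, ℂ)) : 𝓢(E2, ℂ) := ∂_{EuclideanSpace.single i (1 : ℝ)} φ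

lemma fourier_schwartzDx_apply (φ : 𝓢(E2, ℂ)) (j : Fin 2) (ξ : E2) :
    𝓕 (schwartzDx j φ) ξ = 2 * Real.pi * Complex.I * ξ j * 𝓕 φ ξ := by
  rw [schwartzDx, SchwartzMap.fourier_lineDerivOp_eq]
  have : (fun ξ : E2 => inner ℝ ξ (EuclideanSpace.single j (1 : ℝ))).HasTemperateGrowth :=
    ((innerSL ℝ).flip (EuclideanSpace.single j (1 : ℝ))).hasTemperateGrowth
  rw [smul_apply, SchwartzMap.smulLeftCLM_apply_apply this]
  simp [EuclideanSpace.inner_single_right]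
  ring

/-- The Laplacian of a Schwartz function in the standard coordinates. -/
def schwartzLap (φ : 𝓢(E2, ℂ)) : 𝓢(E2, ℂ) :=
  schwartzDx 0 (schwartzDx 0 φ)
    + schwartzDx 1 (schwartzDx 1 φ)

lemma fourier_schwartzLap_apply (φ : 𝓢(E2, ℂ)) (ξ : E2) :
    𝓕 (schwartzLap φ) ξ = -(4 * Real.pi ^ 2 * ‖ξ‖ ^ 2 : ℝ) * 𝓕 φ ξ := by
  rw [schwartzLap, FourierTransform.fourier_add, add_apply]
  simp only [fourier_schwartzDx_apply]
  rw [EuclideanSpace.norm_sq_eq, Fin.sum_univ_two]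
  simp only [Real.norm_eq_abs, sq_abs]
  push_cast
  linear_combination (4 * Real.pi ^ 2 * (ξ 0 ^ 2 + ξ 1 ^ 2) * 𝓕 φ ξ : ℂ) * Complex.I_sq

lemma schwartz_norm_sq_integrable (φ : 𝓢(E2, ℂ)) : Integrable (fun x => ‖φ x‖ ^ 2) :=
  (φ.memLp 2).integrable_norm_pow (by norm_num)

lemma four_pi_sq_ge_one : 1 ≤ 4 * Real.pi ^ 2 := by nlinarith [Real.pi_gt_three]

/-- The Brezis–Gallouet inequality with an explicit frequency cutoff. -/
lemma schwartz_norm_sq_le (φ : 𝓢(E2, ℂ)) {L : ℝ} (hL : 0 < L) (x : E2) :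
    ‖φ x‖ ^ 2 ≤ volume.real (Metric.ball (0 : E2) 1) * Real.log (L + 1)
      * ((∫ y, ‖φ y‖ ^ 2) + (∫ y, ‖schwartzDx 0 φ y‖ ^ 2)
          + (∫ y, ‖schwartzDx 1 φ y‖ ^ 2)
        + (2 * (∫ y, ‖φ y‖ ^ 2) + 2 * ∫ y, ‖schwartzLap φ y‖ ^ 2) / L) := by
  set c := ∫ y : E2, L / ((1 + ‖y‖ ^ 2) * (L + 1 + ‖y‖ ^ 2)) with hc
  rw [← integral_log_weight hL.le, ← hc]
  have i0 := schwartz_norm_sq_integrable (𝓕 φ)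
  have i1 := schwartz_norm_sq_integrable (𝓕 (schwartzDx 0 φ))
  have i2 := schwartz_norm_sq_integrable (𝓕 (schwartzDx 1 φ))
  have i3 := schwartz_norm_sq_integrable (𝓕 (schwartzLap φ))
  rw [← SchwartzMap.integral_norm_sq_fourier φ,
    ← SchwartzMap.integral_norm_sq_fourier (schwartzLap φ),
    ← SchwartzMap.integral_norm_sq_fourier (schwartzDx 0 φ),
    ← SchwartzMap.integral_norm_sq_fourier (schwartzDx 1 φ)]
  set D := (∫ y, ‖𝓕 φ y‖ ^ 2) + (∫ y, ‖𝓕 (schwartzDx 0 φ) y‖ ^ 2)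
          + (∫ y, ‖𝓕 (schwartzDx 1 φ) y‖ ^ 2)
        + (2 * (∫ y, ‖𝓕 φ y‖ ^ 2) + 2 * ∫ y, ‖𝓕 (schwartzLap φ) y‖ ^ 2) / L with hD
  have hD0 : 0 ≤ D := by positivity
  have hc0 : 0 ≤ c := integral_nonneg fun y => log_weight_nonneg hL.le _
  set N : E2 → ℝ := fun y => ‖𝓕 φ y‖ ^ 2 + ‖𝓕 (schwartzDx 0 φ) y‖ ^ 2
      + ‖𝓕 (schwartzDx 1 φ) y‖ ^ 2
      + (2 * ‖𝓕 φ y‖ ^ 2 + 2 * ‖𝓕 (schwartzLap φ) y‖ ^ 2) / L with hN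
  have j1 : Integrable (fun y : E2 => ‖𝓕 φ y‖ ^ 2 + ‖𝓕 (schwartzDx 0 φ) y‖ ^ 2) := i0.add i1
  have j2 : Integrable (fun y : E2 => ‖𝓕 φ y‖ ^ 2 + ‖𝓕 (schwartzDx 0 φ) y‖ ^ 2
      + ‖𝓕 (schwartzDx 1 φ) y‖ ^ 2) := j1.add i2
  have j3 : Integrable (fun y : E2 => (2 * ‖𝓕 φ y‖ ^ 2 + 2 * ‖𝓕 (schwartzLap φ) y‖ ^ 2) / L) :=
    ((i0.const_mul 2).add (i3.const_mul 2)).div_const L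
  have iN : Integrable N := j2.add j3
  have eN : ∫ y, N y = D := by
    rw [hN, integral_add j2 j3, integral_add j1 i2, integral_add i0 i1, integral_div,
      integral_add (i0.const_mul 2) (i3.const_mul 2), integral_const_mul, integral_const_mul]
  have hpt : ∀ y : E2, (1 + ‖y‖ ^ 2) * (L + 1 + ‖y‖ ^ 2) / L * ‖𝓕 φ y‖ ^ 2 ≤ N y := by
    intro y
    have hk := EuclideanSpace.norm_sq_eq y
    rw [Fin.sum_univ_two] at hk
    simp only [Real.norm_eq_abs, sq_abs] at hk
    have hπ := Real.pi_pos
    have e1 : ∀ j, ‖𝓕 (schwartzDx j φ) y‖ ^ 2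
        = 4 * Real.pi ^ 2 * y j ^ 2 * ‖𝓕 φ y‖ ^ 2 := fun j => by
      rw [fourier_schwartzDx_apply]
      simp only [norm_mul, Complex.norm_ofNat, Complex.norm_real, Complex.norm_I, mul_pow,
        Real.norm_eq_abs, sq_abs]
      ring
    have e2 : ‖𝓕 (schwartzLap φ) y‖ ^ 2
        = (4 * Real.pi ^ 2) ^ 2 * (‖y‖ ^ 2) ^ 2 * ‖𝓕 φ y‖ ^ 2 := by
      rw [fourier_schwartzLap_apply, norm_mul, norm_neg, Complex.norm_real, mul_pow,
        Real.norm_eq_abs, sq_abs]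
      ring
    simp only [hN, e1, e2]
    have hp := four_pi_sq_ge_one
    set P := 4 * Real.pi ^ 2
    set k := ‖y‖ ^ 2
    set z := ‖𝓕 φ y‖ ^ 2 with hz
    have hz0 : 0 ≤ z := sq_nonneg _
    have hk0 : 0 ≤ k := sq_nonneg _
    have e3 : (1 + k) * (L + 1 + k) / L * z = z + k * z + (1 + k) ^ 2 * z / L := by
      field_simp
      ring
    have e4 : z + P * y 0 ^ 2 * z + P * y 1 ^ 2 * z = z + P * (k * z) := by rw [hk]; ring
    rw [e3, e4]
    have hkz : 0 ≤ k * z := mul_nonneg hk0 hz0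
    have h5 : (1 + k) ^ 2 * z ≤ 2 * z + 2 * (P ^ 2 * k ^ 2 * z) := by
      have h6 : 1 ≤ P ^ 2 := one_le_pow₀ hp
      have h7 : 0 ≤ k ^ 2 * z := by positivity
      nlinarith [mul_nonneg (sq_nonneg (1 - k)) hz0]
    have h6 := div_le_div_of_nonneg_right h5 hL.le
    nlinarith
  have hI : (∫ ξ, ‖𝓕 φ ξ‖) ^ 2 ≤ 4 * (1 / 4) * (c * D) := by
    refine Sm.le_of_forall_sq_le (by norm_num) hc0 hD0 fun ε hε => ?_
    have h1 : ∫ ξ, ‖𝓕 φ ξ‖ ≤ (ε * c + D / ε) / 2 := by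
      rw [← eN, hc, ← integral_const_mul, ← integral_div, ← integral_add
        ((integrable_log_weight hL.le).const_mul ε) (iN.div_const ε), ← integral_div]
      refine integral_mono (𝓕 φ).integrable.norm
        ((((integrable_log_weight hL.le).const_mul ε).add (iN.div_const ε)).div_const 2) fun y => ?_
      have h2 := div_le_div_of_nonneg_right (hpt y) hε.le
      beta_reduce
      have hw : 0 < (1 + ‖y‖ ^ 2) * (L + 1 + ‖y‖ ^ 2) := by positivity
      set w := (1 + ‖y‖ ^ 2) * (L + 1 + ‖y‖ ^ 2)
      have h3 : ε * (L / w) + w / L * ‖𝓕 φ y‖ ^ 2 / ε - 2 * ‖𝓕 φ y‖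
          = (ε * L - w * ‖𝓕 φ y‖) ^ 2 / (w * L * ε) := by
        field_simp
        ring
      have h4 : 0 ≤ (ε * L - w * ‖𝓕 φ y‖) ^ 2 / (w * L * ε) := by positivity
      linarith
    have h0 : 0 ≤ ∫ ξ, ‖𝓕 φ ξ‖ := integral_nonneg fun _ => norm_nonneg _
    calc _ ≤ ((ε * c + D / ε) / 2) ^ 2 := by gcongr
      _ = _ := by ring
  calc ‖φ x‖ ^ 2 ≤ (∫ ξ, ‖𝓕 φ ξ‖) ^ 2 := by gcongr; exact norm_le_integral_norm_fourier φ x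
    _ ≤ c * D := by linarith

end Fourier

namespace Sm

variable {σ : ℝ} {a b : Sm}

/-! ### Propagation of sup bounds -/

section BrezisGallouet

open scoped LineDeriv SchwartzMap

/-- The constant of the logarithmic Sobolev embedding. -/
def bgConst : ℝ := volume.real (Metric.ball (0 : E2) 1)

lemma bgConst_nonneg : 0 ≤ bgConst := measureReal_nonneg

lemma schwartzDx_eq_dx {F : Sm} {t : ℝ} {φ : 𝓢(E2, ℂ)} (hφ : ∀ x, φ x = (F.1 (t, x) : ℂ))
    (i : Fin 2) (x : E2) : schwartzDx i φ x = ((Dx i F).1 (t, x) : ℂ) := by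
  rw [schwartzDx, SchwartzMap.lineDerivOp_apply_eq_fderiv, ← fderiv_space]
  have h1 : (φ : E2 → ℂ) = fun y => (F.1 (t, y) : ℂ) := funext hφ
  rw [h1]
  have h2 := (hasFDerivAt_space F t x).differentiableAt.hasFDerivAt
  have h3 := (ofRealCLM.hasFDerivAt (x := F.1 (t, x))).comp x h2
  exact DFunLike.congr_fun h3.fderiv _

lemma sq_le_log {F : Sm} (hF : IsS F) {L : ℝ} (hL : 0 < L) (t : ℝ) (x : E2) :
    F.1 (t, x) ^ 2 ≤ bgConst * Real.log (L + 1)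
      * (I (F * F) t + I (Dx 0 F * Dx 0 F) t + I (Dx 1 F * Dx 1 F) t
        + (2 * I (F * F) t + 2 * I (Lap F * Lap F) t) / L) := by
  obtain ⟨f, hf⟩ := hF t
  set φ : 𝓢(E2, ℂ) := f.postcompCLM ofRealCLM with hφd
  have hφ : ∀ x, φ x = (F.1 (t, x) : ℂ) := fun x => by rw [hf]; rfl
  have hD := fun i => schwartzDx_eq_dx hφ i
  have hL2 : ∀ x, schwartzLap φ x = ((Lap F).1 (t, x) : ℂ) := fun x => by
    rw [schwartzLap, _root_.add_apply, schwartzDx_eq_dx (hD 0), schwartzDx_eq_dx (hD 1), Lap,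
      Sm.add_apply]
    push_cast
    rfl
  have key := schwartz_norm_sq_le φ hL x
  have hn : ∀ r : ℝ, ‖(r : ℂ)‖ ^ 2 = r * r := fun r => by
    rw [norm_real, Real.norm_eq_abs, sq_abs, sq]
  simp only [hφ, hD, hL2, hn] at key
  rw [sq]
  exact key

end BrezisGallouet

lemma mass_le_log (ha : IsS a) (hb : IsS b) {L : ℝ} (hL : 0 < L) (t : ℝ) (x : E2) :
    (mass a b).1 (t, x) ≤ bgConst * Real.log (L + 1)
      * (I (mass a b) t + I (grad a b) t + (2 * I (mass a b) t + 2 * I (lapSq a b) t) / L) := by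
  have h1 := sq_le_log ha hL t x
  have h2 := sq_le_log hb hL t x
  have hg : I (grad a b) t = I (Dx 0 a * Dx 0 a) t + I (Dx 1 a * Dx 1 a) t
      + (I (Dx 0 b * Dx 0 b) t + I (Dx 1 b * Dx 1 b) t) := by
    have m := fun (i : Fin 2) => (ha.dx i).mul (ha.dx i)
    have n := fun (i : Fin 2) => (hb.dx i).mul (hb.dx i)
    rw [grad, I_add ((m 0).add (m 1)) ((n 0).add (n 1)), I_add (m 0) (m 1), I_add (n 0) (n 1)]
  rw [mass_apply, hg, mass, lapSq, I_add (ha.mul ha) (hb.mul hb),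
    I_add (ha.lap.mul ha.lap) (hb.lap.mul hb.lap)]
  refine (add_le_add h1 h2).trans (le_of_eq ?_)
  ring

/-- The constant in `I_lapSq_le_of_rho_le`, shifted to enter a logarithm. -/
def supScale (B : ℝ) : ℝ := 2 + 2 * B + 2 * (576 * gnsConst ^ 2 * B ^ 3 + 4 * B)

lemma one_le_supScale {B : ℝ} (hB : 0 ≤ B) : 1 ≤ supScale B := by
  have := gnsConst_nonneg
  have : 0 ≤ 576 * gnsConst ^ 2 * B ^ 3 + 4 * B := by positivity
  rw [supScale]; linarith

lemma mass_le_log_speed (hs : |σ| ≤ 1) (h : RSol σ a b) {t B : ℝ} (hB : I (rho a b) t ≤ B)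
    (x : E2) : (mass a b).1 (t, x)
      ≤ bgConst * (B + 1) * Real.log (supScale B + 4 * I (speed a b) t) := by
  have hM := I_mass_nonneg a b t
  have hG := I_grad_nonneg a b t
  have hV := I_variance_nonneg a b t
  have hr := I_rho h.re h.im t
  have hD := I_lapSq_le_of_rho_le hs h hB
  have hD0 : 0 ≤ I (lapSq a b) t := I_nonneg fun x => by
    simp only [lapSq, add_apply, mul_apply]
    nlinarith [sq_nonneg ((Lap a).1 (t, x)), sq_nonneg ((Lap b).1 (t, x))]
  have hc := bgConst_nonneg
  set D := I (lapSq a b) t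
  set M := I (mass a b) t
  set G := I (grad a b) t
  have hL : 0 < 1 + 2 * M + 2 * D := by linarith
  refine (mass_le_log h.re h.im hL t x).trans ?_
  have h1 : (2 * M + 2 * D) / (1 + 2 * M + 2 * D) ≤ 1 := by
    rw [div_le_one hL]; linarith
  have h2 : Real.log (1 + 2 * M + 2 * D + 1) ≤ Real.log (supScale B + 4 * I (speed a b) t) := by
    apply Real.log_le_log (by linarith)
    rw [supScale]; linarith
  have h3 : 0 ≤ Real.log (1 + 2 * M + 2 * D + 1) := Real.log_nonneg (by linarith)
  have h5 : 0 ≤ B := by linarith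
  calc _ ≤ bgConst * Real.log (supScale B + 4 * I (speed a b) t) * (B + 1) := by
        gcongr ?_ * ?_
        · exact mul_nonneg hc (h3.trans h2)
        · gcongr
        · linarith
    _ = _ := by ring

lemma mass_le_of_bdd (hs : |σ| ≤ 1) (h : RSol σ a b) {s t B X L : ℝ} (hst : s ≤ t)
    (hB : ∀ τ ∈ Icc s t, I (rho a b) τ ≤ B) (hX : Bdd a b X L s t)
    (hδ : 8 * (bgConst * (B + 1)) * (t - s) ≤ 1) : ∀ τ ∈ Icc s t, ∀ x, (mass a b).1 (τ, x) ≤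
      2 * (bgConst * (B + 1) * (1 + Real.log (supScale B + 4 * I (speed a b) s))) := by
  have hB0 : 0 ≤ B := by
    have := hB s ⟨le_rfl, hst⟩
    linarith [I_rho h.re h.im s, I_mass_nonneg a b s, I_grad_nonneg a b s, I_variance_nonneg a b s]
  have hR : 0 ≤ bgConst * (B + 1) := mul_nonneg bgConst_nonneg (by linarith)
  set R := bgConst * (B + 1)
  have hP := one_le_supScale hB0
  set W := I (speed a b) s
  have hW : 0 ≤ W := I_mass_nonneg _ _ _
  have key := le_two_mul_of_half (f := fun p : ℝ × E2 => (mass a b).1 p)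
    (s := {p | p.1 ∈ Icc s t}) (c := R * (1 + Real.log (supScale B + 4 * W)))
    (C := L) (fun p hp => hX.2 p.1 hp p.2) ?_
  · exact fun τ hτ x => key (τ, x) hτ
  rintro S hS ⟨τ, x⟩ hτ
  have hτ' : τ ∈ Icc s t := hτ
  have hS0 : 0 ≤ S := (mass_nonneg a b (s, 0)).trans (hS (s, 0) ⟨le_rfl, hst⟩)
  have h1 : I (speed a b) τ ≤ Real.exp (1 + 4 * S * (τ - s)) * W :=
    speed_le hs h hτ'.1 hS0 (X := B)
      ⟨fun r hr => hB r ⟨hr.1, hr.2.trans hτ'.2⟩, fun r hr y => hS (r, y) ⟨hr.1, hr.2.trans hτ'.2⟩⟩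
  have h2 := mass_le_log_speed hs h (hB τ hτ') x
  have h3 : 0 ≤ 1 + 4 * S * (τ - s) := by
    have := mul_nonneg hS0 (sub_nonneg.2 hτ'.1)
    linarith
  have h4 := Real.one_le_exp h3
  have hWτ : 0 ≤ I (speed a b) τ := I_mass_nonneg _ _ _
  have h5 : Real.log (supScale B + 4 * I (speed a b) τ)
      ≤ (1 + 4 * S * (τ - s)) + Real.log (supScale B + 4 * W) := by
    rw [← Real.log_exp (1 + 4 * S * (τ - s)), ← Real.log_mul (Real.exp_ne_zero _) (by linarith)]
    refine Real.log_le_log (by linarith) ?_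
    nlinarith
  have h6 : R * (4 * S * (τ - s)) ≤ S / 2 := by
    have h7 : 8 * R * (τ - s) ≤ 1 :=
      (mul_le_mul_of_nonneg_left (by linarith [hτ'.2]) (by linarith)).trans hδ
    nlinarith
  calc (mass a b).1 (τ, x) ≤ R * Real.log (supScale B + 4 * I (speed a b) τ) := h2
    _ ≤ R * ((1 + 4 * S * (τ - s)) + Real.log (supScale B + 4 * W)) := by gcongr
    _ ≤ _ := by linarith

/-! ### Time reversal -/

lemma mass_neg_right (a b : Sm) : mass a (-b) = mass a b := by simp only [mass]; ring

lemma grad_neg_right (a b : Sm) : grad a (-b) = grad a b := by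
  simp only [grad, map_neg]; ring

lemma mass_reverse (a b : Sm) :
    mass (timeAff (-1) 0 a) (-timeAff (-1) 0 b) = timeAff (-1) 0 (mass a b) := by
  rw [mass_neg_right, mass_timeAff]

lemma grad_reverse (a b : Sm) :
    grad (timeAff (-1) 0 a) (-timeAff (-1) 0 b) = timeAff (-1) 0 (grad a b) := by
  rw [grad_neg_right, grad_timeAff]

lemma rho_reverse (a b : Sm) :
    rho (timeAff (-1) 0 a) (-timeAff (-1) 0 b) = timeAff (-1) 0 (rho a b) := by
  rw [rho, mass_reverse, grad_reverse, rho]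
  simp only [map_add, map_mul, X2_timeAff]

lemma speed_reverse (a b : Sm) :
    speed (timeAff (-1) 0 a) (-timeAff (-1) 0 b) = timeAff (-1) 0 (speed a b) := by
  simp only [speed, mass, map_neg, Dt_timeAff, map_one, map_add, map_mul]
  ring

lemma reverse_apply (F : Sm) (t : ℝ) (x : E2) : (timeAff (-1) 0 F).1 (t, x) = F.1 (-t, x) := by
  rw [timeAff_apply]; simp

lemma I_reverse (F : Sm) (t : ℝ) : I (timeAff (-1) 0 F) t = I F (-t) := by
  rw [I_timeAff]; simp

lemma Bdd.reverse {X L s t : ℝ} (h : Bdd a b X L s t) :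
    Bdd (timeAff (-1) 0 a) (-timeAff (-1) 0 b) X L (-t) (-s) := by
  have hm : ∀ τ ∈ Icc (-t) (-s), -τ ∈ Icc s t := fun τ hτ =>
    ⟨by linarith [hτ.2], by linarith [hτ.1]⟩
  refine ⟨fun τ hτ => ?_, fun τ hτ x => ?_⟩
  · rw [rho_reverse, I_reverse]
    exact h.1 _ (hm τ hτ)
  · rw [mass_reverse, reverse_apply]
    exact h.2 _ (hm τ hτ) x

lemma mass_le_of_bdd_backward (hs : |σ| ≤ 1) (h : RSol σ a b) {s t B X L : ℝ} (hst : s ≤ t)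
    (hB : ∀ τ ∈ Icc s t, I (rho a b) τ ≤ B) (hX : Bdd a b X L s t)
    (hδ : 8 * (bgConst * (B + 1)) * (t - s) ≤ 1) : ∀ τ ∈ Icc s t, ∀ x, (mass a b).1 (τ, x) ≤
      2 * (bgConst * (B + 1) * (1 + Real.log (supScale B + 4 * I (speed a b) t))) := by
  intro τ hτ x
  have := mass_le_of_bdd hs h.reverse (neg_le_neg hst) (B := B) (fun r hr => by
    rw [rho_reverse, I_reverse]
    exact hB _ ⟨by linarith [hr.2], by linarith [hr.1]⟩) hX.reverse (by linarith) (-τ)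
    ⟨by linarith [hτ.2], by linarith [hτ.1]⟩ x
  rwa [mass_reverse, reverse_apply, speed_reverse, I_reverse, neg_neg, neg_neg] at this

end Sm

namespace Sm

variable {σ : ℝ} {a b : Sm}

/-! ### Local boundedness in time -/

/-- Bounds for the solution and its time derivative at one time. -/
def Ctrl (a b : Sm) (n t : ℝ) : Prop :=
  I (rho a b) t ≤ n ∧ I (speed a b) t ≤ n ∧ ∀ x, (mass a b).1 (t, x) ≤ n

/-- Local boundedness in time of the `ℋ¹` and sup norms. -/
def LocBdd (a b : Sm) (t : ℝ) : Prop :=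
  ∃ C, ∀ᶠ r in 𝓝 t, I (rho a b) r ≤ C ∧ ∀ x, (mass a b).1 (r, x) ≤ C

lemma isOpen_locBdd (a b : Sm) : IsOpen {t | LocBdd a b t} :=
  isOpen_iff_mem_nhds.2 fun _ ⟨C, hC⟩ =>
    (eventually_eventually_nhds.2 hC).mono fun _ hr => ⟨C, hr⟩

lemma exists_bdd_of_locBdd {s t : ℝ} (h : ∀ τ ∈ Icc s t, LocBdd a b τ) :
    ∃ C, 0 ≤ C ∧ Bdd a b C C s t := by
  have key : ∃ C, ∀ τ ∈ Icc s t, I (rho a b) τ ≤ C ∧ ∀ x, (mass a b).1 (τ, x) ≤ C := by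
    refine isCompact_Icc.induction_on ⟨0, fun _ h => h.elim⟩
      (fun K K' hK ⟨C, hC⟩ => ⟨C, fun τ hτ => hC τ (hK hτ)⟩) ?_ fun τ hτ => ?_
    · rintro K K' ⟨C, hC⟩ ⟨C', hC'⟩
      refine ⟨max C C', ?_⟩
      rintro τ (hτ | hτ)
      · exact ⟨(hC τ hτ).1.trans (le_max_left _ _),
          fun x => ((hC τ hτ).2 x).trans (le_max_left _ _)⟩
      · exact ⟨(hC' τ hτ).1.trans (le_max_right _ _),
          fun x => ((hC' τ hτ).2 x).trans (le_max_right _ _)⟩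
    · obtain ⟨C, hC⟩ := h τ hτ
      exact ⟨_, mem_nhdsWithin_of_mem_nhds hC, C, fun r hr => hr⟩
  obtain ⟨C, hC⟩ := key
  exact ⟨max C 0, le_max_right _ _, fun τ hτ => (hC τ hτ).1.trans (le_max_left _ _),
    fun τ hτ x => ((hC τ hτ).2 x).trans (le_max_left _ _)⟩

lemma LocBdd.reverse {t : ℝ} (h : LocBdd a b t) :
    LocBdd (timeAff (-1) 0 a) (-timeAff (-1) 0 b) (-t) := by
  obtain ⟨C, hC⟩ := h
  refine ⟨C, ?_⟩
  have h1 : Tendsto (fun r : ℝ => -r) (𝓝 (-t)) (𝓝 t) := by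
    simpa using (continuous_neg (G := ℝ)).tendsto (-t)
  filter_upwards [h1.eventually hC] with r hr
  simpa only [rho_reverse, mass_reverse, I_reverse, reverse_apply] using hr

lemma LocBdd.of_reverse {t : ℝ}
    (h : LocBdd (timeAff (-1) 0 a) (-timeAff (-1) 0 b) (-t)) : LocBdd a b t := by
  obtain ⟨C, hC⟩ := h
  refine ⟨C, ?_⟩
  filter_upwards [(continuous_neg (G := ℝ)).continuousAt.eventually hC] with r hr
  simpa only [rho_reverse, mass_reverse, I_reverse, reverse_apply, neg_neg] using hr

lemma Ctrl.reverse {n t : ℝ} (h : Ctrl a b n t) :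
    Ctrl (timeAff (-1) 0 a) (-timeAff (-1) 0 b) n (-t) := by
  simpa only [Ctrl, rho_reverse, mass_reverse, speed_reverse, I_reverse, reverse_apply, neg_neg]
    using h

/-- A weighted density dominating `ρ` and the speed. -/
def weightedDensity (a b : Sm) : Sm :=
  X2 * (X2 * (rho a b + speed a b)) + 3 * (X2 * (rho a b + speed a b))
    + 2 * (rho a b + speed a b)

lemma RSol.isS_weightedDensity (h : RSol σ a b) : IsS (weightedDensity a b) := by
  have h1 := (isS_rho h.re h.im).add h.isS_speed
  exact (h1.X2_mul.X2_mul.add (h1.X2_mul.ofNat_mul 3)).add (h1.ofNat_mul 2)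

lemma weightedDensity_apply (a b : Sm) (p : ℝ × E2) : (weightedDensity a b).1 p
    = (1 + ‖p.2‖ ^ 2) * (1 + 1 + ‖p.2‖ ^ 2) * ((rho a b).1 p + (speed a b).1 p) := by
  have h3 : (3 : Sm).1 p = 3 := ofNat_apply p 3
  simp only [weightedDensity, add_apply, mul_apply, X2_eq, h3, two_apply]
  ring

lemma I_le_of_weighted {F : Sm} (hF : IsS F) {n t : ℝ}
    (h : ∀ x : E2, (1 + ‖x‖ ^ 2) * (1 + 1 + ‖x‖ ^ 2) * F.1 (t, x) ≤ n) :
    I F t ≤ n * (bgConst * Real.log (1 + 1)) := by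
  rw [bgConst, ← integral_log_weight zero_le_one, ← integral_const_mul]
  refine integral_mono (hF.integrable t) ((integrable_log_weight zero_le_one).const_mul n)
    fun x => ?_
  beta_reduce
  rw [mul_one_div, le_div_iff₀ (by positivity), mul_comm]
  exact h x

lemma exists_ctrl_of_weighted (h : RSol σ a b) {n : ℝ} (hn : 0 ≤ n) :
    ∃ N, 0 ≤ N ∧ ∀ t, (∀ x, (weightedDensity a b).1 (t, x) ≤ n) → Ctrl a b N t := by
  have hJ : 0 ≤ bgConst * Real.log (1 + 1) :=
    mul_nonneg bgConst_nonneg (Real.log_nonneg (by norm_num))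
  refine ⟨n * (bgConst * Real.log (1 + 1)) + n, by positivity, fun t ht => ?_⟩
  simp only [weightedDensity_apply] at ht
  have hr := fun x => rho_nonneg a b (t, x)
  have hw : ∀ x, 0 ≤ (speed a b).1 (t, x) := fun x => mass_nonneg (Dt a) (Dt b) (t, x)
  have hm := fun x => mass_le_rho a b (t, x)
  refine ⟨?_, ?_, fun x => ?_⟩
  · refine (I_le_of_weighted (isS_rho h.re h.im) fun x => ?_).trans (le_add_of_nonneg_right hn)
    refine le_trans ?_ (ht x)
    gcongr
    exact le_add_of_nonneg_right (hw x)
  · refine (I_le_of_weighted h.isS_speed fun x => ?_).trans (le_add_of_nonneg_right hn)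
    refine le_trans ?_ (ht x)
    gcongr
    exact le_add_of_nonneg_left (hr x)
  · refine le_trans ?_ (le_add_of_nonneg_left (by positivity))
    refine le_trans ?_ (ht x)
    have h1 : 1 ≤ (1 + ‖x‖ ^ 2) * (1 + 1 + ‖x‖ ^ 2) := by nlinarith [sq_nonneg ‖x‖]
    have h2 := hr x
    have h3 := hw x
    nlinarith [hm x]

lemma exists_forward_bound (hs : |σ| ≤ 1) (h : RSol σ a b) (α β : ℝ) {n : ℝ} (hn : 0 ≤ n) :
    ∃ δ, 0 < δ ∧ ∃ C, ∀ q t, α ≤ q → q ≤ t → t ≤ β → t - q ≤ δ → Ctrl a b n q →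
      (∀ τ ∈ Ioc q t, LocBdd a b τ) → I (rho a b) t ≤ C ∧ ∀ x, (mass a b).1 (t, x) ≤ C := by
  obtain ⟨B, hB0, hB⟩ := exists_rho_bound hs h α β n hn
  have hc := bgConst_nonneg
  have hsmall : ∀ {A e : ℝ}, 0 ≤ A → e ≤ 1 / (8 * (bgConst * (A + 1)) + 1) →
      8 * (bgConst * (A + 1)) * e ≤ 1 := fun {A e} hA he => by
    have h1 : 0 ≤ 8 * (bgConst * (A + 1)) := by positivity
    calc _ ≤ 8 * (bgConst * (A + 1)) * (1 / (8 * (bgConst * (A + 1)) + 1)) := by gcongr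
      _ ≤ 1 := by rw [mul_one_div, div_le_one (by linarith)]; linarith
  refine ⟨min (1 / 8) (1 / (8 * (bgConst * (B + 1)) + 1)), by positivity,
    max n (max B (2 * (bgConst * (B + 1) * (1 + Real.log (supScale B + 4 * n))))),
    fun q t hαq hqt htβ hδ hq hloc => ?_⟩
  rcases hqt.eq_or_lt with rfl | hlt
  · exact ⟨hq.1.trans (le_max_left _ _), fun x => (hq.2.2 x).trans (le_max_left _ _)⟩
  have hδ1 : t - q ≤ 1 / 8 := hδ.trans (min_le_left _ _)
  have hbdd : ∀ s, q < s → ∃ C, 0 ≤ C ∧ Bdd a b C C s t := fun s hs' =>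
    exists_bdd_of_locBdd fun τ hτ => hloc τ ⟨hs'.trans_le hτ.1, hτ.2⟩
  obtain ⟨n₁, hn₁, hbt⟩ := hbdd t hlt
  obtain ⟨B₁, hB₁0, hB₁⟩ := exists_rho_bound hs h α β n₁ hn₁
  have hX : ∀ τ ∈ Ioc q t, I (rho a b) τ ≤ B₁ := fun τ hτ => by
    obtain ⟨C, hC0, hC⟩ := hbdd τ hτ.1
    exact hB₁ τ t C C t (hαq.trans hτ.1.le) htβ (by linarith [hτ.1]) hC0 hC ⟨hτ.2, le_rfl⟩
      (hbt.1 t ⟨le_rfl, le_rfl⟩) (hbt.2 t ⟨le_rfl, le_rfl⟩) τ ⟨le_rfl, hτ.2⟩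
  set e := 1 / (8 * (bgConst * (B₁ + 1)) + 1)
  have he : 0 < e := by positivity
  set t₁ := min t (q + e)
  have hqt₁ : q < t₁ := lt_min hlt (by linarith)
  have ht₁t : t₁ ≤ t := min_le_left _ _
  have ht₁e : t₁ - q ≤ e := by linarith [min_le_right t (q + e)]
  obtain ⟨C₂, hC₂0, hC₂⟩ := hbdd t₁ hqt₁
  set Λ := 2 * (bgConst * (B₁ + 1) * (1 + Real.log (supScale B₁ + 4 * I (speed a b) t₁)))
  have hΛ : ∀ τ ∈ Ioc q t₁, ∀ x, (mass a b).1 (τ, x) ≤ Λ := fun τ hτ => by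
    obtain ⟨C, hC0, hC⟩ := hbdd τ hτ.1
    exact mass_le_of_bdd_backward hs h hτ.2
      (fun r hr => hX r ⟨hτ.1.trans_le hr.1, hr.2.trans ht₁t⟩) (hC.mono le_rfl ht₁t)
      (hsmall hB₁0 (by linarith [hτ.1])) τ ⟨le_rfl, hτ.2⟩
  have hall : Bdd a b (max n B₁) (max n (max Λ C₂)) q t := by
    refine ⟨fun τ hτ => ?_, fun τ hτ x => ?_⟩
    · rcases hτ.1.eq_or_lt with rfl | h1
      · exact hq.1.trans (le_max_left _ _)
      · exact (hX τ ⟨h1, hτ.2⟩).trans (le_max_right _ _)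
    · rcases hτ.1.eq_or_lt with rfl | h1
      · exact (hq.2.2 x).trans (le_max_left _ _)
      · refine le_trans ?_ (le_max_right _ _)
        rcases le_total τ t₁ with h2 | h2
        · exact (hΛ τ ⟨h1, h2⟩ x).trans (le_max_left _ _)
        · exact (hC₂.2 τ ⟨h2, hτ.2⟩ x).trans (le_max_right _ _)
  have hfin := hB q t _ _ q hαq htβ hδ1 (hn.trans (le_max_left _ _)) hall ⟨le_rfl, hqt⟩ hq.1 hq.2.2
  have hsup := mass_le_of_bdd hs h hqt hfin hall (hsmall hB0 (hδ.trans (min_le_right _ _)))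
  have ht : t ∈ Icc q t := ⟨hqt, le_rfl⟩
  refine ⟨(hfin t ht).trans ((le_max_left _ _).trans (le_max_right _ _)), fun x => ?_⟩
  refine (hsup t ht x).trans (le_trans ?_ ((le_max_right _ _).trans (le_max_right _ _)))
  have hP := one_le_supScale hB0
  have hW : 0 ≤ I (speed a b) q := I_mass_nonneg _ _ _
  gcongr
  exact hq.2.1

lemma exists_right_bound (hs : |σ| ≤ 1) (h : RSol σ a b) {p ε n : ℝ} (hε : 0 < ε) (hn : 0 ≤ n)
    (hp : ¬LocBdd a b p) (hF : ∀ q, |q - p| < ε → LocBdd a b q ∨ Ctrl a b n q) :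
    ∃ η, 0 < η ∧ ∃ C, ∀ t, p ≤ t → t < p + η →
      I (rho a b) t ≤ C ∧ ∀ x, (mass a b).1 (t, x) ≤ C := by
  obtain ⟨δ, hδ, C, hC⟩ := exists_forward_bound hs h p (p + 1) hn
  refine ⟨min ε (min δ 1), by positivity, C, fun t hpt ht => ?_⟩
  have h1 : t < p + ε := ht.trans_le (by gcongr; exact min_le_left _ _)
  have h2 : t < p + δ := ht.trans_le (by gcongr; exact (min_le_right _ _).trans (min_le_left _ _))
  have h3 : t < p + 1 := ht.trans_le (by gcongr; exact (min_le_right _ _).trans (min_le_right _ _))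
  have hK : IsCompact (Icc p t ∩ {τ | LocBdd a b τ}ᶜ) :=
    isCompact_Icc.inter_right (isOpen_locBdd a b).isClosed_compl
  obtain ⟨q, ⟨hq, hqb⟩, hqm⟩ := hK.exists_isGreatest ⟨p, ⟨le_rfl, hpt⟩, hp⟩
  refine hC q t hq.1 hq.2 h3.le (by linarith [hq.1])
    ((hF q (abs_lt.2 ⟨by linarith [hq.1], by linarith [hq.2]⟩)).resolve_left hqb) fun τ hτ => ?_
  by_contra hτb
  exact hτ.1.not_ge (hqm ⟨⟨hq.1.trans hτ.1.le, hτ.2⟩, hτb⟩)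

lemma locBdd (hs : |σ| ≤ 1) (h : RSol σ a b) (t : ℝ) : LocBdd a b t := by
  by_contra ht
  set F : Set ℝ := {τ | LocBdd a b τ}ᶜ with hFd
  have hFc : IsClosed F := (isOpen_locBdd a b).isClosed_compl
  have : Nonempty F := ⟨⟨t, ht⟩⟩
  have : CompleteSpace F := hFc.completeSpace_coe
  obtain ⟨k, p, hp⟩ := nonempty_interior_of_iUnion_of_closed (X := F) (ι := ℕ)
    (f := fun k => {q | ∀ x, (weightedDensity a b).1 ((q : ℝ), x) ≤ k})
    (fun k => by
      simp only [ofPred_forall]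
      exact isClosed_iInter fun x => isClosed_le
        ((continuous_time _ x).comp continuous_subtype_val) continuous_const)
    (eq_univ_of_forall fun q => by
      obtain ⟨C, hC⟩ := h.isS_weightedDensity.bounded q
      obtain ⟨k, hk⟩ := exists_nat_ge C
      exact mem_iUnion.2 ⟨k, fun x => (hC x).trans hk⟩)
  obtain ⟨N, hN0, hN⟩ := exists_ctrl_of_weighted h (n := k) k.cast_nonneg
  obtain ⟨ε, hε, hball⟩ := Metric.mem_nhds_iff.1 (mem_interior_iff_mem_nhds.1 hp)
  have hF : ∀ q : ℝ, |q - (p : ℝ)| < ε → LocBdd a b q ∨ Ctrl a b N q := fun q hq => by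
    by_cases hqF : LocBdd a b q
    · exact .inl hqF
    · exact .inr (hN q (hball (show (⟨q, hqF⟩ : F) ∈ Metric.ball p ε from hq)))
  obtain ⟨η, hη, C, hC⟩ := exists_right_bound hs h hε hN0 p.2 hF
  obtain ⟨η', hη', C', hC'⟩ := exists_right_bound hs h.reverse (p := -p) hε hN0
    (fun hr => p.2 hr.of_reverse)
    (fun q hq => by
      have h1 := hF (-q) (by rw [← abs_neg]; convert hq using 2; ring)
      rw [← neg_neg q]
      exact h1.imp LocBdd.reverse Ctrl.reverse)
  refine p.2 ⟨max C C', ?_⟩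
  filter_upwards [Ioo_mem_nhds (show (p : ℝ) - η' < p by linarith)
    (show (p : ℝ) < p + η by linarith)]
    with r hr
  rcases le_total (p : ℝ) r with h1 | h1
  · obtain ⟨h2, h3⟩ := hC r h1 hr.2
    exact ⟨h2.trans (le_max_left _ _), fun x => (h3 x).trans (le_max_left _ _)⟩
  · obtain ⟨h2, h3⟩ := hC' (-r) (by linarith) (by linarith [hr.1])
    rw [rho_reverse, I_reverse, neg_neg] at h2
    simp only [mass_reverse, reverse_apply, neg_neg] at h3
    exact ⟨h2.trans (le_max_right _ _), fun x => (h3 x).trans (le_max_right _ _)⟩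

/-- The energy of a Schwartz-regular solution is conserved. -/
theorem RSol.I_energy_eq (hs : |σ| ≤ 1) (h : RSol σ a b) {s t : ℝ} (hst : s ≤ t) :
    I (energy σ a b) t = I (energy σ a b) s := by
  obtain ⟨C, hC0, hC⟩ := exists_bdd_of_locBdd (s := s) (t := t) fun τ _ => locBdd hs h τ
  exact (conserved_of_bdd hs h hst hC0 hC).2.1

end Sm

section RealForm

open Sm

lemma pd_eq_dx {f : E2 → ℂ} {a b : Sm} {t : ℝ}
    (hf : ∀ y, f y = (a.1 (t, y) : ℂ) + b.1 (t, y) * Complex.I) (i : Fin 2) (x : E2) :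
    pd i f x = ((Dx i a).1 (t, x) : ℂ) + (Dx i b).1 (t, x) * Complex.I := by
  have ha := (hasFDerivAt_space a t x).differentiableAt.hasFDerivAt
  have hb := (hasFDerivAt_space b t x).differentiableAt.hasFDerivAt
  have h1 := ((ofRealCLM.hasFDerivAt (x := a.1 (t, x))).comp x ha).add
    (((ofRealCLM.hasFDerivAt (x := b.1 (t, x))).comp x hb).mul_const Complex.I)
  have h2 : f = fun y => (a.1 (t, y) : ℂ) + b.1 (t, y) * Complex.I := funext hf
  rw [pd, h2, ← fderiv_space, ← fderiv_space]
  refine (DFunLike.congr_fun h1.fderiv (EuclideanSpace.single i 1)).trans ?_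
  simp [mul_comm]

lemma lap_eq_lap {f : E2 → ℂ} {a b : Sm} {t : ℝ}
    (hf : ∀ y, f y = (a.1 (t, y) : ℂ) + b.1 (t, y) * Complex.I) (x : E2) :
    lap f x = ((Lap a).1 (t, x) : ℂ) + (Lap b).1 (t, x) * Complex.I := by
  rw [lap, Fin.sum_univ_two, pd_eq_dx (pd_eq_dx hf 0), pd_eq_dx (pd_eq_dx hf 1), Lap, Lap,
    Sm.add_apply, Sm.add_apply]
  push_cast
  ring

lemma gradSq_eq_grad {f : E2 → ℂ} {a b : Sm} {t : ℝ}
    (hf : ∀ y, f y = (a.1 (t, y) : ℂ) + b.1 (t, y) * Complex.I) (x : E2) :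
    gradSq f x = (grad a b).1 (t, x) := by
  rw [gradSq, Fin.sum_univ_two, pd_eq_dx hf, pd_eq_dx hf, grad_apply]
  simp only [Complex.sq_norm, normSq_add_mul_I]
  ring

variable {σ : ℝ} {u : ℝ → SchwartzMap E2 ℂ}

lemma IsSolution.exists_rSol (hu : IsSolution σ u) :
    ∃ a b : Sm, RSol σ a b ∧ ∀ t x, u t x = (a.1 (t, x) : ℂ) + b.1 (t, x) * Complex.I := by
  obtain ⟨hsm, heq⟩ := hu
  set a : Sm := ⟨fun p => (u p.1 p.2).re, reCLM.contDiff.comp hsm⟩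
  set b : Sm := ⟨fun p => (u p.1 p.2).im, imCLM.contDiff.comp hsm⟩
  have hab : ∀ t x, u t x = (a.1 (t, x) : ℂ) + b.1 (t, x) * Complex.I := fun t x =>
    (re_add_im _).symm
  have key : ∀ p : ℝ × E2, ((Dt a).1 p + (Dt b).1 p * Complex.I : ℂ)
      = ((Lap b - (X2 + algebraMap ℝ Sm σ * (a * a + b * b)) * b).1 p : ℂ)
        + ((-(Lap a - (X2 + algebraMap ℝ Sm σ * (a * a + b * b)) * a)).1 p : ℂ) * Complex.I := by
    rintro ⟨t, x⟩
    have hd : deriv (fun s => u s x) t = ((Dt a).1 (t, x) : ℂ) + (Dt b).1 (t, x) * Complex.I := by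
      have h1 := (hasDerivAt_time a t x).ofReal_comp.add
        ((hasDerivAt_time b t x).ofReal_comp.mul_const Complex.I)
      have h2 : (fun s => u s x) = fun s => (a.1 (s, x) : ℂ) + b.1 (s, x) * Complex.I :=
        funext fun s => hab s x
      rw [h2]
      exact h1.deriv
    have h := heq t x
    rw [hd, lap_eq_lap (hab t)] at h
    have hn : (‖u t x‖ : ℂ) ^ 2 = ((a.1 (t, x) ^ 2 + b.1 (t, x) ^ 2 : ℝ) : ℂ) := by
      rw [← ofReal_pow, hab t x, Complex.sq_norm, normSq_add_mul_I]
    rw [hn, hab t x] at h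
    simp only [Sm.sub_apply, Sm.neg_apply, Sm.mul_apply, Sm.add_apply, Sm.const_apply, X2_eq]
    push_cast at h ⊢
    linear_combination -Complex.I * h + (((Dt a).1 (t, x) : ℂ) + (Dt b).1 (t, x) * Complex.I
      - (Lap b).1 (t, x) + ((‖x‖ : ℂ) ^ 2
        + σ * ((a.1 (t, x) : ℂ) ^ 2 + (b.1 (t, x) : ℂ) ^ 2)) * b.1 (t, x)) * I_sq
  refine ⟨a, b, ⟨?_, ?_, fun t => ?_, fun t => ?_⟩, hab⟩
  · ext p
    simpa using congrArg re (key p)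
  · ext p
    simpa using congrArg im (key p)
  · exact ⟨(u t).postcompCLM reCLM, fun x => rfl⟩
  · exact ⟨(u t).postcompCLM imCLM, fun x => rfl⟩

lemma hamiltonian_eq_energy {a b : Sm} (h : RSol σ a b)
    (hab : ∀ t x, u t x = (a.1 (t, x) : ℂ) + b.1 (t, x) * Complex.I) (t : ℝ) :
    (1/2) * ((∫ x : E2, gradSq (fun y => u t y) x) + ∫ x : E2, ‖x‖^2 * ‖u t x‖^2)
      + (σ/4) * ∫ x : E2, ‖u t x‖^4 = (1/4) * Sm.I (energy σ a b) t := by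
  have hm : ∀ x, ‖u t x‖ ^ 2 = (mass a b).1 (t, x) := fun x => by
    rw [hab, Complex.sq_norm, normSq_add_mul_I, mass_apply]
  have hm4 : ∀ x, ‖u t x‖ ^ 4 = (mass a b * mass a b).1 (t, x) := fun x => by
    rw [show ‖u t x‖ ^ 4 = ‖u t x‖ ^ 2 * ‖u t x‖ ^ 2 by ring, hm, Sm.mul_apply]
  have hv : ∀ x : E2, ‖x‖ ^ 2 * ‖u t x‖ ^ 2 = (X2 * mass a b).1 (t, x) := fun x => by
    rw [hm, Sm.mul_apply, X2_eq]
  have iM := isS_mass h.re h.im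
  have iG := isS_grad h.re h.im
  simp only [gradSq_eq_grad (hab t), hv, hm4]
  have e : Sm.I (energy σ a b) t = 2 * Sm.I (grad a b) t + 2 * Sm.I (X2 * mass a b) t
      + σ * Sm.I (mass a b * mass a b) t := by
    rw [energy, I_add ((iG.ofNat_mul 2).add (iM.X2_mul.ofNat_mul 2)) ((iM.mul iM).const_mul σ),
      I_add (iG.ofNat_mul 2) (iM.X2_mul.ofNat_mul 2), I_two_mul, I_two_mul, I_const_mul]
  rw [e]
  simp only [Sm.I]
  ring

end RealForm

end Conservation

/-- Conservation of the Hamiltonian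
`½(‖∇u(t)‖² + ‖|x|u(t)‖²) + (σ/4)‖u(t)‖⁴_{L⁴}` for the cubic NLS with harmonic potential. -/
theorem hamiltonian_conservation (σ : ℝ) (hσ : σ = 1 ∨ σ = -1)
    (u : ℝ → SchwartzMap E2 ℂ) (hu : IsSolution σ u) (s t : ℝ) :
    (1/2) * ((∫ x : E2, gradSq (fun y => u s y) x) + ∫ x : E2, ‖x‖^2 * ‖u s x‖^2)
      + (σ/4) * ∫ x : E2, ‖u s x‖^4
    = (1/2) * ((∫ x : E2, gradSq (fun y => u t y) x) + ∫ x : E2, ‖x‖^2 * ‖u t x‖^2)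
      + (σ/4) * ∫ x : E2, ‖u t x‖^4 := by
  obtain ⟨a, b, h, hab⟩ := hu.exists_rSol
  have hs : |σ| ≤ 1 := by rcases hσ with rfl | rfl <;> simp
  rw [hamiltonian_eq_energy h hab, hamiltonian_eq_energy h hab]
  rcases le_total s t with hst | hst
  · rw [h.I_energy_eq hs hst]
  · rw [h.I_energy_eq hs hst]
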